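/- Assume L > 4/√3 and let σ₀ = max{ μ(μ−1)(2−μ)/2 : μ ∈ (1,2) and (√3 L/4) μ(2−μ) ∈ ℤ }. Let s ≥ 1 be an integer, K > 0, γ₀ > σ₀ and M > 0. Then there exists C > 0 such that for every τ ∈ ℝ with |τ| ≤ M, every k ∈ ℤ with |k/L| ≤ K, and all complex-valued Schwartz functions w, W, H on ℝ with W' = w, satisfying the resolvent equation (γ₀ + iτ) w − w' + (Q w)' + w''' + (k²/L²) W = H', one has ‖w‖_{H^s(ℝ)}² ≤ C ‖H‖_{H^{s+1}(ℝ)}². -/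

import Mathlib

open MeasureTheory

/-- The KdV soliton profile `Q(x) = 3 sech²(x/2)`. -/
noncomputable def Q (x : ℝ) : ℝ := 3 * (1 / Real.cosh (x / 2)) ^ 2

/-- The maximal unstable growth rate `σ₀ = max{ μ(μ−1)(2−μ)/2 : μ ∈ (1,2),
(√3 L/4) μ(2−μ) ∈ ℤ }`. -/
noncomputable def sigma0 (L : ℝ) : ℝ :=
  sSup {x : ℝ | ∃ μ : ℝ, 1 < μ ∧ μ < 2 ∧ x = μ * (μ - 1) * (2 - μ) / 2 ∧
    ∃ k : ℤ, (k : ℝ) = Real.sqrt 3 * L / 4 * (μ * (2 - μ))}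

/-- The squared `H^s(ℝ)` norm `Σ_{m ≤ s} ‖∂ₓ^m f‖²_{L²}`. -/
noncomputable def HsSq (s : ℕ) (f : ℝ → ℂ) : ℝ :=
  ∑ m ∈ Finset.range (s + 1), ∫ x : ℝ, ‖iteratedDeriv m f x‖ ^ 2

/-- The resolvent equation `(γ₀ + iτ) w − w' + (Qw)' + w''' + (k²/L²) W = H'`
on the transverse mode `k/L`, where `W` is the antiderivative of `w`. -/
def ResolventEq (L γ₀ τ : ℝ) (k : ℤ) (w W H : ℝ → ℂ) : Prop :=
  (∀ x : ℝ, deriv W x = w x) ∧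
  ∀ x : ℝ, ((γ₀ : ℂ) + τ * Complex.I) * w x - deriv w x
      + deriv (fun y : ℝ => (Q y : ℂ) * w y) x + iteratedDeriv 3 w x
      + (((k : ℝ) ^ 2 / L ^ 2 : ℝ) : ℂ) * W x = deriv H x


namespace KP
open SchwartzMap
open scoped ComplexConjugate

abbrev Sw := SchwartzMap ℝ ℂ

/-- embedding into L². -/
noncomputable def io : Sw →L[ℂ] Lp ℂ 2 (volume : Measure ℝ) := SchwartzMap.toLpCLM ℂ ℂ 2 volume

/-- derivative on Schwartz functions. -/
noncomputable def d : Sw →L[ℂ] Sw := SchwartzMap.derivCLM ℂ ℂ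

/-- multiplication by a Schwartz function. -/
noncomputable def mu (g : Sw) : Sw →L[ℂ] Sw := SchwartzMap.smulLeftCLM ℂ (g : ℝ → ℂ)

/-- L² inner product. -/
noncomputable def ip (f g : Sw) : ℂ := inner ℂ (io f) (io g)

/-- L² norm. -/
noncomputable def nm (f : Sw) : ℝ := ‖io f‖

lemma d_apply (f : Sw) (x : ℝ) : d f x = deriv f x := rfl

lemma mu_apply (g f : Sw) (x : ℝ) : mu g f x = g x * f x := by
  unfold mu
  rw [SchwartzMap.smulLeftCLM_apply_apply (SchwartzMap.hasTemperateGrowth g)]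
  rfl

lemma hasDeriv (f : Sw) (x : ℝ) : HasDerivAt f (d f x) x := SchwartzMap.hasDerivAt f x

lemma eq_d_of_hasDeriv (f g : Sw) (h : ∀ x, HasDerivAt f (g x) x) : d f = g := by
  ext x
  exact (h x).deriv

lemma d_mu (g f : Sw) : d (mu g f) = mu (d g) f + mu g (d f) := by
  apply eq_d_of_hasDeriv
  intro x
  have h1 : (⇑(mu g f)) = fun x => g x * f x := by funext x; exact mu_apply g f x
  rw [h1]
  have := (hasDeriv g x).mul (hasDeriv f x)
  have h2 : (mu (d g) f + mu g (d f)) x = d g x * f x + g x * d f x := by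
    rw [add_apply, mu_apply, mu_apply]
  rw [h2]
  exact this

lemma ip_eq (f g : Sw) : ip f g = ∫ x, conj (f x) * g x := by
  unfold ip io
  simp only [SchwartzMap.toLpCLM_apply]
  rw [SchwartzMap.inner_toL2_toL2_eq f g volume]
  simp [RCLike.inner_apply, mul_comm]

lemma ip_self (f : Sw) : ip f f = ((nm f ^ 2 : ℝ) : ℂ) := by
  unfold ip nm
  rw [inner_self_eq_norm_sq_to_K]; simp

lemma ip_self_re (f : Sw) : (ip f f).re = nm f ^ 2 := by
  rw [ip_self]; exact Complex.ofReal_re _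

lemma nm_sq (f : Sw) : nm f ^ 2 = ∫ x, ‖f x‖ ^ 2 := by
  have h := ip_eq f f
  rw [ip_self] at h
  have h2 : ∀ x, conj (f x) * f x = ((‖f x‖ ^ 2 : ℝ) : ℂ) := by
    intro x
    rw [mul_comm, Complex.mul_conj, Complex.normSq_eq_norm_sq]
  simp_rw [h2] at h
  rw [integral_complex_ofReal] at h
  exact_mod_cast h

lemma nm_nonneg (f : Sw) : 0 ≤ nm f := norm_nonneg _

lemma ip_symm (f g : Sw) : conj (ip f g) = ip g f := inner_conj_symm _ _

lemma ip_add_left (f g h : Sw) : ip (f + g) h = ip f h + ip g h := by simp [ip, inner_add_left]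
lemma ip_add_right (f g h : Sw) : ip f (g + h) = ip f g + ip f h := by simp [ip, inner_add_right]
lemma ip_sub_left (f g h : Sw) : ip (f - g) h = ip f h - ip g h := by simp [ip, inner_sub_left]
lemma ip_sub_right (f g h : Sw) : ip f (g - h) = ip f g - ip f h := by simp [ip, inner_sub_right]
lemma ip_neg_left (f h : Sw) : ip (-f) h = - ip f h := by simp [ip]
lemma ip_neg_right (f h : Sw) : ip f (-h) = - ip f h := by simp [ip]
lemma ip_smul_left (c : ℂ) (f h : Sw) : ip (c • f) h = conj c * ip f h := by
  simp [ip, inner_smul_left]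
lemma ip_smul_right (c : ℂ) (f h : Sw) : ip f (c • h) = c * ip f h := by
  simp [ip, inner_smul_right]

lemma ip_le (f g : Sw) : ‖ip f g‖ ≤ nm f * nm g := norm_inner_le_norm _ _

lemma nm_add (f g : Sw) : nm (f + g) ≤ nm f + nm g := by simpa [nm] using norm_add_le (io f) (io g)
lemma nm_sub (f g : Sw) : nm (f - g) ≤ nm f + nm g := by simpa [nm] using norm_sub_le (io f) (io g)
lemma nm_smul (c : ℂ) (f : Sw) : nm (c • f) = ‖c‖ * nm f := by simp [nm, norm_smul]

lemma ip_d (f g : Sw) : ip (d f) g = - ip f (d g) := by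
  rw [ip_eq, ip_eq]
  have h := SchwartzMap.integral_mul_deriv_eq_neg_deriv_mul
    (SchwartzMap.postcompCLM (𝕜 := ℝ) (Complex.conjCLE : ℂ →L[ℝ] ℂ) f) g
  have h3 : ∀ x, deriv (⇑(SchwartzMap.postcompCLM (𝕜 := ℝ) (Complex.conjCLE : ℂ →L[ℝ] ℂ) f)) x
      = conj (d f x) := by
    intro x
    have h4 : (⇑(SchwartzMap.postcompCLM (𝕜 := ℝ) (Complex.conjCLE : ℂ →L[ℝ] ℂ) f))
      = fun x => conj (f x) := by
      funext y; simp [SchwartzMap.postcompCLM_apply]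
    rw [h4]
    exact (HasDerivAt.star (hasDeriv f x)).deriv
  simp only [h3, SchwartzMap.postcompCLM_apply] at h
  simp only [← d_apply] at h
  rw [eq_neg_iff_add_eq_zero]
  have h5 : ∀ x, ((Complex.conjCLE : ℂ →L[ℝ] ℂ) (f x)) = conj (f x) := fun x => by simp
  simp only [h5] at h
  rw [h]; ring

lemma nm_mu_le (g : Sw) (B : ℝ) (hB : ∀ x, ‖g x‖ ≤ B) (f : Sw) : nm (mu g f) ≤ B * nm f := by
  have hB0 : 0 ≤ B := le_trans (norm_nonneg _) (hB 0)
  refine abs_le_of_sq_le_sq' ?_ (mul_nonneg hB0 (nm_nonneg f)) |>.2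
  rw [mul_pow, nm_sq, nm_sq, ← integral_const_mul]
  have hsqi : ∀ u : Sw, Integrable (fun x => ‖u x‖ ^ 2) := by
    intro u
    exact (u.memLp 2).integrable_norm_pow (by norm_num)
  apply integral_mono (hsqi _) ((hsqi f).const_mul _)
  intro x
  simp only [mu_apply, norm_mul, mul_pow]
  exact mul_le_mul_of_nonneg_right (pow_le_pow_left₀ (norm_nonneg _) (hB x) 2) (by positivity)

lemma exists_bound (g : Sw) : ∃ B, ∀ x, ‖g x‖ ≤ B :=
  ⟨_, fun x => SchwartzMap.norm_le_seminorm ℝ g x⟩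

lemma ip_mu (g f h : Sw) (hg : ∀ x, conj (g x) = g x) : ip (mu g f) h = ip f (mu g h) := by
  rw [ip_eq, ip_eq]
  congr 1; funext x
  simp only [mu_apply, map_mul, hg]; ring

lemma nm_d_sq (f : Sw) : nm (d f) ^ 2 ≤ nm f * nm (d (d f)) := by
  rw [← ip_self_re, ip_d]
  have := ip_le f (d (d f))
  have h2 := Complex.abs_re_le_norm (ip f (d (d f)))
  rw [Complex.neg_re]
  linarith [neg_le_abs (ip f (d (d f))).re]

lemma ip_d_self_re (f : Sw) : (ip f (d f)).re = 0 := by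
  have h1 := ip_d f f
  have h2 := ip_symm f (d f)
  have h3 : (ip (d f) f).re = (ip f (d f)).re := by rw [← h2]; simp
  have h4 : (ip (d f) f).re = - (ip f (d f)).re := by rw [h1]; simp
  linarith

/-- a Schwartz function with zero derivative vanishes. -/
lemma eq_zero_of_d (f : Sw) (h : d f = 0) : f = 0 := by
  have hc : ∀ x y, f x = f y := by
    apply is_const_of_deriv_eq_zero f.differentiable
    intro x
    rw [← d_apply, h]; rfl
  have ht := f.tendsto_cocompact
  have h2 : (f : ℝ → ℂ) = fun _ => f 0 := by funext x; exact hc x 0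
  rw [h2] at ht
  have := tendsto_nhds_unique ht tendsto_const_nhds
  ext x
  rw [hc x 0, ← this]; rfl

lemma mu_bound (r : ℕ) : ∀ g : Sw, ∃ C : ℝ, 0 ≤ C ∧ ∀ f : Sw,
    nm (d^[r] (mu g f)) ≤ C * ∑ i ∈ Finset.range (r + 1), nm (d^[i] f) := by
  induction r with
  | zero =>
    intro g
    obtain ⟨B, hB⟩ := exists_bound g
    refine ⟨B, le_trans (norm_nonneg _) (hB 0), fun f => ?_⟩
    simpa using nm_mu_le g B hB f
  | succ r ih =>
    intro g
    obtain ⟨C1, h10, h1⟩ := ih (d g)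
    obtain ⟨C2, h20, h2⟩ := ih g
    refine ⟨C1 + C2, by positivity, fun f => ?_⟩
    have key : d^[r+1] (mu g f) = d^[r] (mu (d g) f) + d^[r] (mu g (d f)) := by
      rw [Function.iterate_succ_apply, d_mu]
      exact iterate_map_add d r _ _
    rw [key]
    have e1 : ∑ i ∈ Finset.range (r + 1), nm (d^[i] f) ≤ ∑ i ∈ Finset.range (r + 1 + 1), nm (d^[i] f) := by
      rw [Finset.sum_range_succ _ (r+1)]
      linarith [nm_nonneg (d^[r+1] f)]
    have e2 : ∑ i ∈ Finset.range (r + 1), nm (d^[i] (d f)) ≤ ∑ i ∈ Finset.range (r + 1 + 1), nm (d^[i] f) := by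
      rw [Finset.sum_range_succ' _ (r+1)]
      simp only [← Function.iterate_succ_apply]
      linarith [nm_nonneg (d^[0] f)]
    have := nm_add (d^[r] (mu (d g) f)) (d^[r] (mu g (d f)))
    have a1 := h1 f
    have a2 := h2 (d f)
    have b1 := mul_le_mul_of_nonneg_left e1 h10
    have b2 := mul_le_mul_of_nonneg_left e2 h20
    linarith

end KP

namespace KP
open Polynomial

noncomputable def gfun (p : ℕ) (a : ℝ) (P : ℝ[X]) (x : ℝ) : ℝ :=
  Real.exp (a * x) * (1 / Real.cosh (x / 2)) ^ p * P.eval (Real.tanh (x / 2))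

noncomputable def del (p : ℕ) (a : ℝ) (P : ℝ[X]) : ℝ[X] :=
  C a * P - C ((p : ℝ) / 2) * X * P + C (1 / 2 : ℝ) * (1 - X ^ 2) * derivative P

lemma hasDeriv_tanh_half (x : ℝ) : HasDerivAt (fun x : ℝ => Real.tanh (x / 2))
    ((1 - Real.tanh (x / 2) ^ 2) / 2) x := by
  have hc := (Real.cosh_pos (x / 2)).ne'
  have h1 : HasDerivAt (fun x : ℝ => x / 2) (1 / 2) x := (hasDerivAt_id x).div_const 2
  have h2 := (h1.sinh).div (h1.cosh) hc
  have h3 : (fun x : ℝ => Real.tanh (x / 2)) = fun x => Real.sinh (x/2) / Real.cosh (x/2) := by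
    funext y; exact Real.tanh_eq_sinh_div_cosh _
  rw [h3]
  refine h2.congr_deriv ?_
  rw [Real.tanh_eq_sinh_div_cosh]
  field_simp

lemma hasDeriv_sech_pow (p : ℕ) (x : ℝ) : HasDerivAt (fun x : ℝ => (1 / Real.cosh (x / 2)) ^ p)
    (-((p : ℝ) / 2) * Real.tanh (x / 2) * (1 / Real.cosh (x / 2)) ^ p) x := by
  have hc := (Real.cosh_pos (x / 2)).ne'
  have h1 : HasDerivAt (fun x : ℝ => x / 2) (1 / 2) x := (hasDerivAt_id x).div_const 2
  have h2 := ((h1.cosh).inv hc).pow p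
  have h3 : (fun x : ℝ => (1 / Real.cosh (x / 2)) ^ p) = (fun x => (Real.cosh (x/2))⁻¹) ^ p := by
    funext y; simp
  rw [h3]
  refine h2.congr_deriv ?_
  rw [Real.tanh_eq_sinh_div_cosh]
  rcases p with _ | p
  · simp
  · simp only [Nat.add_sub_cancel, Pi.inv_apply]
    push_cast
    simp only [one_div, inv_pow, pow_succ]
    field_simp

lemma hasDeriv_gfun (p : ℕ) (a : ℝ) (P : ℝ[X]) (x : ℝ) :
    HasDerivAt (gfun p a P) (gfun p a (del p a P) x) x := by
  have h1 : HasDerivAt (fun x : ℝ => Real.exp (a * x)) (Real.exp (a * x) * (a * 1)) x :=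
    ((hasDerivAt_id x).const_mul a).exp
  have h2 := hasDeriv_sech_pow p x
  have h3 : HasDerivAt (fun x : ℝ => P.eval (Real.tanh (x / 2)))
    ((derivative P).eval (Real.tanh (x/2)) * ((1 - Real.tanh (x / 2) ^ 2) / 2)) x :=
    HasDerivAt.comp (h₂ := fun y => P.eval y) x (P.hasDerivAt (Real.tanh (x/2))) (hasDeriv_tanh_half x)
  have h4 := (h1.mul h2).mul h3
  refine h4.congr_deriv ?_
  simp only [gfun, del, eval_add, eval_sub, eval_mul, eval_C, eval_X, eval_pow, eval_one]
  simp only [Pi.mul_apply]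
  ring

lemma abs_tanh_le (x : ℝ) : |Real.tanh x| ≤ 1 := by
  have hc := Real.cosh_pos x
  rw [Real.tanh_eq_sinh_div_cosh, abs_div, abs_of_pos hc, div_le_one hc]
  apply abs_le_of_sq_le_sq _ hc.le
  have := Real.cosh_sq x
  linarith

lemma sech_le (x : ℝ) : 1 / Real.cosh (x / 2) ≤ 2 * Real.exp (-(|x| / 2)) := by
  have hc := Real.cosh_pos (x / 2)
  rw [div_le_iff₀ hc, ← Real.cosh_abs, abs_div, abs_of_pos (two_pos : (0:ℝ) < 2), Real.cosh_eq]
  have h1 : Real.exp (-(|x|/2)) * Real.exp (|x|/2) = 1 := by rw [← Real.exp_add]; simp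
  have h2 := mul_pos (Real.exp_pos (-(|x|/2))) (Real.exp_pos (-(|x|/2)))
  nlinarith

lemma gfun_decay (p : ℕ) (a : ℝ) (h : |a| < p / 2) (P : ℝ[X]) (k : ℕ) :
    ∃ C, ∀ x, |x| ^ k * |gfun p a P x| ≤ C := by
  obtain ⟨B, hB⟩ := (isCompact_Icc (a := (-1:ℝ)) (b := 1)).exists_bound_of_continuousOn
    (P.continuous.continuousOn)
  have hB0 : 0 ≤ B := le_trans (norm_nonneg _) (hB 0 (by norm_num))
  set δ : ℝ := p / 2 - |a| with hδ
  have hδ0 : 0 < δ := by linarith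
  refine ⟨k.factorial / δ ^ k * 2 ^ p * B, fun x => ?_⟩
  have h1 : |P.eval (Real.tanh (x / 2))| ≤ B := hB _ (abs_le.mp (abs_tanh_le _))
  have h2 : (1 / Real.cosh (x / 2)) ^ p ≤ 2 ^ p * Real.exp (-(p / 2 * |x|)) := by
    calc (1 / Real.cosh (x / 2)) ^ p ≤ (2 * Real.exp (-(|x| / 2))) ^ p :=
          pow_le_pow_left₀ (by have := Real.cosh_pos (x/2); positivity) (sech_le x) p
      _ = _ := by rw [mul_pow, ← Real.exp_nat_mul]; congr 2; ring
  have h3 : Real.exp (a * x) ≤ Real.exp (|a| * |x|) := by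
    apply Real.exp_le_exp.mpr
    rw [← abs_mul]; exact le_abs_self _
  have h4 : (δ * |x|) ^ k / k.factorial ≤ Real.exp (δ * |x|) :=
    Real.pow_div_factorial_le_exp _ (by positivity) k
  have hs0 : 0 ≤ (1 / Real.cosh (x / 2)) ^ p := by have := Real.cosh_pos (x/2); positivity
  have h5 : |gfun p a P x| ≤ Real.exp (|a| * |x|) * (2 ^ p * Real.exp (-(p / 2 * |x|))) * B := by
    unfold gfun
    rw [abs_mul, abs_mul, abs_of_pos (Real.exp_pos _), abs_of_nonneg hs0]
    gcongr
  have h6 : Real.exp (|a| * |x|) * (2 ^ p * Real.exp (-(p / 2 * |x|))) * B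
      = 2 ^ p * B * Real.exp (-(δ * |x|)) := by
    have : Real.exp (-(δ * |x|)) = Real.exp (|a| * |x|) * Real.exp (-(p / 2 * |x|)) := by
      rw [← Real.exp_add]; congr 1; rw [hδ]; ring
    rw [this]; ring
  have h7 : |x| ^ k ≤ k.factorial / δ ^ k * Real.exp (δ * |x|) := by
    rw [div_le_iff₀ (by positivity), mul_pow] at h4
    rw [div_mul_eq_mul_div, le_div_iff₀ (by positivity)]
    linarith
  have h8 : Real.exp (δ * |x|) * Real.exp (-(δ * |x|)) = 1 := by rw [← Real.exp_add]; simp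
  calc |x| ^ k * |gfun p a P x| ≤ (k.factorial / δ ^ k * Real.exp (δ * |x|)) * (2 ^ p * B * Real.exp (-(δ * |x|))) := by
        rw [← h6]
        apply mul_le_mul h7 h5 (abs_nonneg _) (by positivity)
    _ = k.factorial / δ ^ k * 2 ^ p * B * (Real.exp (δ * |x|) * Real.exp (-(δ * |x|))) := by ring
    _ = _ := by rw [h8, mul_one]

lemma hasDeriv_gfunC (p : ℕ) (a : ℝ) (P : ℝ[X]) (x : ℝ) :
    HasDerivAt (fun x => (gfun p a P x : ℂ)) (gfun p a (del p a P) x : ℂ) x :=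
  (hasDeriv_gfun p a P x).ofReal_comp

lemma iter_gfunC (p : ℕ) (a : ℝ) (n : ℕ) (P : ℝ[X]) :
    iteratedDeriv n (fun x => (gfun p a P x : ℂ)) = fun x => (gfun p a ((del p a)^[n] P) x : ℂ) := by
  induction n generalizing P with
  | zero => simp
  | succ n ih =>
    rw [iteratedDeriv_succ', Function.iterate_succ_apply, ← ih]
    congr 1
    funext x
    exact (hasDeriv_gfunC p a P x).deriv

noncomputable def G (p : ℕ) (a : ℝ) (h : |a| < p / 2) (P : ℝ[X]) : Sw where
  toFun x := (gfun p a P x : ℂ)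
  smooth' := by
    apply contDiff_of_differentiable_iteratedDeriv
    intro m _
    rw [iter_gfunC]
    intro x
    exact (hasDeriv_gfunC p a _ x).differentiableAt
  decay' := by
    intro k n
    obtain ⟨C, hC⟩ := gfun_decay p a h ((del p a)^[n] P) k
    refine ⟨C, fun x => ?_⟩
    rw [norm_iteratedFDeriv_eq_norm_iteratedDeriv, iter_gfunC]
    simpa using hC x

lemma G_apply (p : ℕ) (a : ℝ) (h : |a| < p / 2) (P : ℝ[X]) (x : ℝ) :
    G p a h P x = (gfun p a P x : ℂ) := rfl

lemma d_G (p : ℕ) (a : ℝ) (h : |a| < p / 2) (P : ℝ[X]) : d (G p a h P) = G p a h (del p a P) :=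
  eq_d_of_hasDeriv _ _ (fun x => hasDeriv_gfunC p a P x)

lemma G_add (p : ℕ) (a : ℝ) (h : |a| < p / 2) (P R : ℝ[X]) :
    G p a h P + G p a h R = G p a h (P + R) := by
  ext x
  rw [add_apply]
  simp only [G_apply, gfun, eval_add]
  push_cast; ring

lemma G_sub (p : ℕ) (a : ℝ) (h : |a| < p / 2) (P R : ℝ[X]) :
    G p a h P - G p a h R = G p a h (P - R) := by
  ext x
  rw [sub_apply]
  simp only [G_apply, gfun, eval_sub]
  push_cast; ring

lemma G_smul (p : ℕ) (a : ℝ) (h : |a| < p / 2) (P : ℝ[X]) (c : ℝ) :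
    (c : ℂ) • G p a h P = G p a h (C c * P) := by
  ext x
  rw [smul_apply]
  simp only [G_apply, gfun, eval_mul, eval_C, smul_eq_mul]
  push_cast; ring

/-- the soliton as a Schwartz function -/
noncomputable def Qs : Sw := G 2 0 (by norm_num) (C 3)

lemma Qs_apply (x : ℝ) : Qs x = (Q x : ℂ) := by
  simp only [Qs, G_apply, gfun, Q, eval_C]
  simp; ring

lemma sech_sq (x : ℝ) : (1 / Real.cosh x) ^ 2 = 1 - Real.tanh x ^ 2 := by
  have hc := (Real.cosh_pos x).ne'
  rw [Real.tanh_eq_sinh_div_cosh]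
  field_simp
  have := Real.cosh_sq x
  linarith

lemma Q_eq (x : ℝ) : Q x = 3 * (1 - Real.tanh (x / 2) ^ 2) := by
  rw [Q, sech_sq]

lemma Q_nonneg (x : ℝ) : 0 ≤ Q x := by
  rw [Q]; positivity

lemma Q_le (x : ℝ) : Q x ≤ 3 := by
  rw [Q_eq]; nlinarith [sq_nonneg (Real.tanh (x/2))]

/-- multiplication by the soliton -/
noncomputable def q : Sw →L[ℂ] Sw := mu Qs

lemma q_apply (f : Sw) (x : ℝ) : q f x = (Q x : ℂ) * f x := by
  rw [q, mu_apply, Qs_apply]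

lemma q_G (p : ℕ) (a : ℝ) (h : |a| < p / 2) (P : ℝ[X]) :
    q (G p a h P) = G p a h (C 3 * (1 - X ^ 2) * P) := by
  ext x
  rw [q_apply, Q_eq]
  simp only [G_apply, gfun, eval_mul, eval_C, eval_sub, eval_one, eval_pow, eval_X]
  push_cast; ring

lemma ip_q (f h : Sw) : ip (q f) h = ip f (q h) := by
  apply ip_mu
  intro x; rw [Qs_apply, Complex.conj_ofReal]

lemma nm_q (f : Sw) : nm (q f) ≤ 3 * nm f := by
  apply nm_mu_le
  intro x
  rw [Qs_apply, Complex.norm_real, Real.norm_eq_abs, abs_of_nonneg (Q_nonneg x)]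
  exact Q_le x

end KP

namespace KP
open Filter Topology
open scoped ComplexConjugate

/-- logarithmic derivative of the derivative of Q -/
noncomputable def rr (x : ℝ) : ℝ := (1 - 3 * Real.tanh (x / 2) ^ 2) / (2 * Real.tanh (x / 2))

lemma tanh_half_pos {x : ℝ} (hx : 0 < x) : 0 < Real.tanh (x / 2) := by
  rw [Real.tanh_eq_sinh_div_cosh]
  exact div_pos (Real.sinh_pos_iff.mpr (by linarith)) (Real.cosh_pos _)

lemma hasDeriv_rr {x : ℝ} (hx : 0 < x) : HasDerivAt rr (1 - Q x - rr x ^ 2) x := by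
  have ht := tanh_half_pos hx
  have h := hasDeriv_tanh_half x
  have h1 := ((h.pow 2).const_mul 3).const_sub 1
  have h2 := h.const_mul 2
  have h3 := h1.div h2 (by positivity)
  refine h3.congr_deriv ?_
  rw [Q_eq]
  simp only [rr, Pi.pow_apply]
  field_simp
  ring

lemma half_line (u u' : ℝ → ℂ) (hd : ∀ x, HasDerivAt u (u' x) x) (hc : Continuous u')
    (h0 : u 0 = 0) (hinf : Tendsto u atTop (𝓝 0))
    (hF : Integrable (fun x => ‖u' x‖ ^ 2 + (1 - Q x) * ‖u x‖ ^ 2)) :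
    0 ≤ ∫ x in Set.Ioi (0:ℝ), (‖u' x‖ ^ 2 + (1 - Q x) * ‖u x‖ ^ 2) := by
  set F : ℝ → ℝ := fun x => ‖u' x‖ ^ 2 + (1 - Q x) * ‖u x‖ ^ 2 with hFdef
  have hu : Continuous u := continuous_iff_continuousAt.mpr fun x => (hd x).continuousAt
  have htc : Continuous (fun x : ℝ => Real.tanh (x / 2)) :=
    continuous_iff_continuousAt.mpr fun x => (hasDeriv_tanh_half x).continuousAt
  have hQc : Continuous Q := by
    have : Q = fun x => 3 * (1 - Real.tanh (x / 2) ^ 2) := funext Q_eq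
    rw [this]; fun_prop
  have hFc : Continuous F := by rw [hFdef]; fun_prop
  set h : ℝ → ℝ := fun x => (∫ y in (0:ℝ)..x, F y) - rr x * ‖u x‖ ^ 2 with hh
  have hder : ∀ x : ℝ, 0 < x → HasDerivAt h (‖u' x - rr x • u x‖ ^ 2) x := by
    intro x hx
    have e1 : HasDerivAt (fun x => ∫ y in (0:ℝ)..x, F y) (F x) x :=
      intervalIntegral.integral_hasDerivAt_right (hFc.intervalIntegrable _ _)
        hFc.stronglyMeasurable.stronglyMeasurableAtFilter hFc.continuousAt
    have e2 := (hasDeriv_rr hx).mul (hd x).norm_sq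
    refine (e1.sub e2).congr_deriv ?_
    rw [norm_sub_sq_real, norm_smul, inner_smul_right, real_inner_comm, hFdef, mul_pow,
      Real.norm_eq_abs, sq_abs]
    ring
  have hmono : MonotoneOn h (Set.Ioi 0) := by
    apply monotoneOn_of_deriv_nonneg (convex_Ioi 0)
    · intro x hx; exact (hder x hx).continuousAt.continuousWithinAt
    · intro x hx; rw [interior_Ioi] at hx; exact (hder x hx).differentiableAt.differentiableWithinAt
    · intro x hx; rw [interior_Ioi] at hx; rw [(hder x hx).deriv]; positivity
  have hlim0 : Tendsto h (𝓝[>] 0) (𝓝 0) := by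
    have e1 : Tendsto (fun x => ∫ y in (0:ℝ)..x, F y) (𝓝[>] 0) (𝓝 0) := by
      have : Continuous (fun x => ∫ y in (0:ℝ)..x, F y) :=
        intervalIntegral.continuous_primitive (fun a b => hFc.intervalIntegrable a b) 0
      have h2 := (this.tendsto 0)
      rw [intervalIntegral.integral_same] at h2
      exact h2.mono_left nhdsWithin_le_nhds
    have s1 : Tendsto (fun x => x⁻¹ • u x) (𝓝[>] 0) (𝓝 (u' 0)) := by
      have := (hasDerivAt_iff_tendsto_slope.mp (hd 0)).mono_left
        (nhdsWithin_mono 0 (fun x (hx : 0 < x) => (ne_of_gt hx : x ≠ 0)) : 𝓝[>] (0:ℝ) ≤ 𝓝[≠] 0)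
      refine this.congr ?_
      intro x; simp [slope, h0]
    have s2 : Tendsto (fun x : ℝ => x⁻¹ * Real.tanh (x / 2)) (𝓝[>] 0) (𝓝 (1 / 2)) := by
      have := (hasDerivAt_iff_tendsto_slope.mp (hasDeriv_tanh_half 0)).mono_left
        (nhdsWithin_mono 0 (fun x (hx : 0 < x) => (ne_of_gt hx : x ≠ 0)) : 𝓝[>] (0:ℝ) ≤ 𝓝[≠] 0)
      simp at this
      refine Tendsto.congr ?_ (by simpa using this)
      intro x; simp [slope]
    have s3 : Tendsto (fun x : ℝ => (1 - 3 * Real.tanh (x / 2) ^ 2) / 2) (𝓝[>] 0) (𝓝 (1 / 2)) := by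
      have : Continuous (fun x : ℝ => (1 - 3 * Real.tanh (x / 2) ^ 2) / 2) := by fun_prop
      have h2 := this.tendsto 0
      simp at h2
      simpa using h2.mono_left nhdsWithin_le_nhds
    have s4 : Tendsto (fun x : ℝ => x) (𝓝[>] 0) (𝓝 0) := nhdsWithin_le_nhds
    have s5 := ((s3.mul (s2.inv₀ (by norm_num))).mul (s1.norm.pow 2)).mul s4
    rw [mul_zero] at s5
    have s6 : Tendsto (fun x => rr x * ‖u x‖ ^ 2) (𝓝[>] 0) (𝓝 0) := by
      refine s5.congr' ?_
      filter_upwards [self_mem_nhdsWithin] with x hx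
      have hx' : (0:ℝ) < x := hx
      have ht := tanh_half_pos hx'
      rw [rr, norm_smul, Real.norm_eq_abs, abs_of_pos (inv_pos.mpr hx')]
      field_simp
    have := e1.sub s6
    simpa using this
  have hpos : ∀ x, 0 < x → 0 ≤ h x := by
    intro x hx
    refine le_of_tendsto hlim0 ?_
    filter_upwards [Ioo_mem_nhdsGT hx] with y hy
    exact hmono hy.1 hx hy.2.le
  have hlim1 : Tendsto h atTop (𝓝 (∫ x in Set.Ioi (0:ℝ), F x)) := by
    have e1 : Tendsto (fun x => ∫ y in (0:ℝ)..x, F y) atTop (𝓝 (∫ x in Set.Ioi (0:ℝ), F x)) :=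
      intervalIntegral_tendsto_integral_Ioi 0 hF.integrableOn tendsto_id
    have e2 : Tendsto (fun x => rr x * ‖u x‖ ^ 2) atTop (𝓝 0) := by
      have : Tendsto (fun x => 4 * ‖u x‖ ^ 2) atTop (𝓝 0) := by
        have := (hinf.norm.pow 2).const_mul 4
        simpa using this
      refine squeeze_zero_norm' ?_ this
      filter_upwards [eventually_ge_atTop 4] with x hx
      have ht := tanh_half_pos (show 0 < x by linarith)
      have ht1 := (abs_le.mp (abs_tanh_le (x/2))).2
      have hs := sech_le x
      have hs2 := sech_sq (x / 2)
      have hcp := Real.cosh_pos (x / 2)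
      have hsp : 0 < 1 / Real.cosh (x / 2) := by positivity
      have he : Real.exp (-(|x| / 2)) ≤ 1 / 3 := by
        rw [abs_of_pos (show 0 < x by linarith), Real.exp_neg, ← one_div]
        apply one_div_le_one_div_of_le (by norm_num)
        linarith [Real.add_one_le_exp (x / 2)]
      have ht2 : 1 / 2 ≤ Real.tanh (x / 2) := by
        by_contra hcon
        push Not at hcon
        nlinarith
      have hr : |rr x| ≤ 4 := by
        rw [rr, abs_div, abs_of_pos (show 0 < 2 * Real.tanh (x/2) by positivity), div_le_iff₀ (by positivity), abs_le]
        constructor <;> nlinarith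
      rw [norm_mul, Real.norm_eq_abs, norm_pow, norm_norm]
      exact mul_le_mul_of_nonneg_right hr (by positivity)
    have := e1.sub e2
    simpa using this
  refine ge_of_tendsto hlim1 ?_
  filter_upwards [eventually_gt_atTop 0] with x hx
  exact hpos x hx

/-- the form of `L₀ = -∂² + 1 - Q` -/
noncomputable def a0 (f g : Sw) : ℂ := ip (d f) (d g) + ip f g - ip (q f) g

lemma integrable_sq (f : Sw) : Integrable (fun x => ‖f x‖ ^ 2) :=
  (f.memLp 2).integrable_norm_pow (by norm_num)

lemma integrable_Qsq (f : Sw) : Integrable (fun x => Q x * ‖f x‖ ^ 2) := by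
  have h : Integrable (fun x => conj (q f x) * f x) := by
    have := ((SchwartzMap.memLp (q f) 2).star.integrable_mul (SchwartzMap.memLp f 2))
    exact this
  have h2 := h.re
  refine h2.congr (Eventually.of_forall fun x => ?_)
  simp only [q_apply, map_mul, Complex.conj_ofReal]
  rw [mul_assoc, mul_comm (conj (f x)), Complex.mul_conj, Complex.normSq_eq_norm_sq, ← Complex.ofReal_mul]
  exact Complex.ofReal_re _

lemma ip_q_self (f : Sw) : ip (q f) f = ((∫ x, Q x * ‖f x‖ ^ 2 : ℝ) : ℂ) := by
  rw [ip_eq, ← integral_complex_ofReal]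
  congr 1; funext x
  simp only [q_apply, map_mul, Complex.conj_ofReal]
  rw [mul_assoc, mul_comm (conj (f x)), Complex.mul_conj, Complex.normSq_eq_norm_sq, ← Complex.ofReal_mul]

lemma a0_self (f : Sw) : (a0 f f).re = ∫ x, (‖d f x‖ ^ 2 + (1 - Q x) * ‖f x‖ ^ 2) := by
  have h1 : ∀ x, ‖d f x‖ ^ 2 + (1 - Q x) * ‖f x‖ ^ 2 = ‖d f x‖ ^ 2 + ‖f x‖ ^ 2 - Q x * ‖f x‖ ^ 2 := by
    intro x; ring
  simp_rw [h1]
  have hi : Integrable (fun x => ‖d f x‖ ^ 2 + ‖f x‖ ^ 2) :=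
    (integrable_sq _).add (integrable_sq _)
  rw [integral_sub hi (integrable_Qsq f), integral_add (integrable_sq _) (integrable_sq _), ← nm_sq, ← nm_sq]
  simp only [a0, Complex.sub_re, Complex.add_re, ip_self_re, ip_q_self, Complex.ofReal_re]

lemma integrable_F (f : Sw) : Integrable (fun x => ‖d f x‖ ^ 2 + (1 - Q x) * ‖f x‖ ^ 2) := by
  have h1 : ∀ x, ‖d f x‖ ^ 2 + (1 - Q x) * ‖f x‖ ^ 2 = ‖d f x‖ ^ 2 + ‖f x‖ ^ 2 - Q x * ‖f x‖ ^ 2 := by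
    intro x; ring
  simp_rw [h1]
  exact ((integrable_sq _).add (integrable_sq _)).sub (integrable_Qsq f)

lemma Q_even (x : ℝ) : Q (-x) = Q x := by
  unfold Q; rw [neg_div, Real.cosh_neg]

lemma a0_nonneg (f : Sw) (h0 : f 0 = 0) : 0 ≤ (a0 f f).re := by
  rw [a0_self, ← integral_add_compl (measurableSet_Ioi (a := (0:ℝ))) (integrable_F f), Set.compl_Ioi]
  have hz := f.tendsto_cocompact
  have hF := integrable_F f
  apply add_nonneg
  · exact half_line f (d f) (hasDeriv f) (d f).continuous h0 (hz.mono_left atTop_le_cocompact) hF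
  · have h := half_line (fun x => f (-x)) (fun x => - d f (-x))
      (fun x => by
        have := (hasDeriv f (-x)).scomp x (hasDerivAt_neg x)
        exact this.congr_deriv (by simp))
      ((d f).continuous.comp continuous_neg).neg (by simpa using h0)
      ((hz.mono_left atBot_le_cocompact).comp tendsto_neg_atTop_atBot) ?_
    · have h3 := integral_comp_neg_Ioi (0:ℝ) (fun x => ‖d f x‖ ^ 2 + (1 - Q x) * ‖f x‖ ^ 2)
      rw [neg_zero] at h3
      rw [← h3]
      simpa [Q_even] using h
    · have := hF.comp_neg
      simpa [Q_even] using this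

end KP

namespace KP
open Filter Topology
open scoped ComplexConjugate

/-- The self-adjoint operator `∂⁴ - ∂² + ∂ Q ∂ + c`. -/
noncomputable def N (c : ℝ) : Sw →L[ℂ] Sw :=
  d.comp (d.comp (d.comp d)) - d.comp d + d.comp (q.comp d) + (c : ℂ) • ContinuousLinearMap.id ℂ Sw

lemma N_apply (c : ℝ) (X : Sw) :
    N c X = d (d (d (d X))) - d (d X) + d (q (d X)) + (c : ℂ) • X := rfl

/-- The hermitian form of `N c`. -/
noncomputable def fa (c : ℝ) (X Y : Sw) : ℂ := ip (N c X) Y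

lemma fa_eq (c : ℝ) (X Y : Sw) : fa c X Y = a0 (d X) (d Y) + c * ip X Y := by
  rw [fa, N_apply, ip_add_left, ip_add_left, ip_sub_left, ip_smul_left, Complex.conj_ofReal,
    ip_d (d (d (d X))), ip_d (d (d X)) (d Y), ip_d (d X) Y, ip_d (q (d X)) Y, a0]
  ring

lemma a0_symm (f g : Sw) : conj (a0 f g) = a0 g f := by
  rw [a0, a0, map_sub, map_add, ip_symm, ip_symm, ip_symm, ip_q]

lemma fa_symm (c : ℝ) (X Y : Sw) : conj (fa c X Y) = fa c Y X := by
  rw [fa_eq, fa_eq, map_add, a0_symm, map_mul, ip_symm, Complex.conj_ofReal]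

lemma fa_N (c : ℝ) (X Y : Sw) : fa c X Y = ip X (N c Y) := by
  rw [← fa_symm, fa, ip_symm]

lemma fa_add_left (c : ℝ) (X Y Z : Sw) : fa c (X + Y) Z = fa c X Z + fa c Y Z := by
  simp only [fa, map_add, ip_add_left]
lemma fa_sub_left (c : ℝ) (X Y Z : Sw) : fa c (X - Y) Z = fa c X Z - fa c Y Z := by
  simp only [fa, map_sub, ip_sub_left]
lemma fa_smul_left (c : ℝ) (k : ℂ) (X Z : Sw) : fa c (k • X) Z = conj k * fa c X Z := by
  simp only [fa, map_smul, ip_smul_left]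
lemma fa_add_right (c : ℝ) (X Y Z : Sw) : fa c Z (X + Y) = fa c Z X + fa c Z Y := by
  simp only [fa, ip_add_right]
lemma fa_sub_right (c : ℝ) (X Y Z : Sw) : fa c Z (X - Y) = fa c Z X - fa c Z Y := by
  simp only [fa, ip_sub_right]
lemma fa_smul_right (c : ℝ) (k : ℂ) (X Z : Sw) : fa c Z (k • X) = k * fa c Z X := by
  simp only [fa, ip_smul_right]

lemma fa_self_im (c : ℝ) (X : Sw) : (fa c X X).im = 0 :=
  Complex.conj_eq_iff_im.mp (fa_symm c X X)

lemma fa_self_eq (c : ℝ) (X : Sw) : fa c X X = ((fa c X X).re : ℂ) :=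
  (Complex.conj_eq_iff_re.mp (fa_symm c X X)).symm

lemma fa_decomp (c : ℝ) (E W : Sw) (k : ℂ) :
    (fa c W W).re = - (fa c E E).re * ‖k‖ ^ 2 + 2 * (conj k * fa c E W).re
      + (fa c (W - k • E) (W - k • E)).re := by
  have h1 : fa c W E = conj (fa c E W) := (fa_symm c E W).symm
  have h2 := Complex.normSq_eq_norm_sq k
  simp only [fa_sub_left, fa_sub_right, fa_smul_left, fa_smul_right, h1]
  rw [fa_self_eq c E, ← h2]
  simp [Complex.normSq_apply]
  ring

/-- second order norm -/
noncomputable def n2 (X : Sw) : ℝ := nm X + nm (d X) + nm (d (d X))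

lemma n2_nonneg (X : Sw) : 0 ≤ n2 X := by
  have := nm_nonneg X; have := nm_nonneg (d X); have := nm_nonneg (d (d X))
  unfold n2; positivity
lemma nm_le_n2 (X : Sw) : nm X ≤ n2 X := by
  have := nm_nonneg (d X); have := nm_nonneg (d (d X))
  unfold n2; linarith
lemma nm_d_le_n2 (X : Sw) : nm (d X) ≤ n2 X := by
  have := nm_nonneg (X); have := nm_nonneg (d (d X))
  unfold n2; linarith
lemma nm_dd_le_n2 (X : Sw) : nm (d (d X)) ≤ n2 X := by
  have := nm_nonneg (X); have := nm_nonneg (d X)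
  unfold n2; linarith

lemma n2_add (X Y : Sw) : n2 (X + Y) ≤ n2 X + n2 Y := by
  unfold n2
  simp only [map_add]
  linarith [nm_add X Y, nm_add (d X) (d Y), nm_add (d (d X)) (d (d Y))]

lemma n2_smul (k : ℂ) (X : Sw) : n2 (k • X) = ‖k‖ * n2 X := by
  unfold n2
  simp only [map_smul, nm_smul]; ring

lemma a0_le (f g : Sw) : ‖a0 f g‖ ≤ nm (d f) * nm (d g) + 4 * (nm f * nm g) := by
  have h1 := ip_le (d f) (d g)
  have h2 := ip_le f g
  have h3 := ip_le (q f) g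
  have h4 := mul_le_mul_of_nonneg_right (nm_q f) (nm_nonneg g)
  have h5 := norm_sub_le (ip (d f) (d g) + ip f g) (ip (q f) g)
  have h6 := norm_add_le (ip (d f) (d g)) (ip f g)
  unfold a0
  linarith

lemma fa_le (c : ℝ) (hc : 0 ≤ c) (X Y : Sw) : ‖fa c X Y‖ ≤ (5 + c) * (n2 X * n2 Y) := by
  rw [fa_eq]
  have h1 := a0_le (d X) (d Y)
  have h2 := ip_le X Y
  have h3 := norm_add_le (a0 (d X) (d Y)) (c * ip X Y)
  rw [norm_mul, Complex.norm_real, Real.norm_eq_abs, abs_of_nonneg hc] at h3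
  have a1 := mul_le_mul (nm_le_n2 X) (nm_le_n2 Y) (nm_nonneg _) (n2_nonneg _)
  have a2 := mul_le_mul (nm_d_le_n2 X) (nm_d_le_n2 Y) (nm_nonneg _) (n2_nonneg _)
  have a3 := mul_le_mul (nm_dd_le_n2 X) (nm_dd_le_n2 Y) (nm_nonneg _) (n2_nonneg _)
  have a4 := mul_le_mul_of_nonneg_left (h2.trans a1) hc
  linarith

/-- Gårding inequality -/
lemma a0_garding (f : Sw) : nm (d f) ^ 2 - 2 * nm f ^ 2 ≤ (a0 f f).re := by
  have h3 := ip_le (q f) f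
  have h4 := mul_le_mul_of_nonneg_right (nm_q f) (nm_nonneg f)
  have h5 := Complex.re_le_norm (ip (q f) f)
  simp only [a0, Complex.sub_re, Complex.add_re, ip_self_re]
  nlinarith

lemma fa_garding (c : ℝ) (X : Sw) :
    nm (d (d X)) ^ 2 ≤ 2 * (fa c X X).re + (4 - 2 * c) * nm X ^ 2 := by
  have h1 := a0_garding (d X)
  have h2 := nm_d_sq X
  have h3 : (fa c X X).re = (a0 (d X) (d X)).re + c * nm X ^ 2 := by
    rw [fa_eq, ip_self, ← Complex.ofReal_mul]; simp [pow_two]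
  nlinarith [sq_nonneg (nm (d (d X)) - 2 * nm X)]

lemma n2_sq_le (X : Sw) : n2 X ^ 2 ≤ 5 * (nm X ^ 2 + nm (d (d X)) ^ 2) := by
  have h2 := nm_d_sq X
  have := nm_nonneg X; have := nm_nonneg (d X); have h := nm_nonneg (d (d X))
  unfold n2
  nlinarith [sq_nonneg (nm (d (d X)) - nm X), sq_nonneg (nm (d X) - nm X), sq_nonneg (nm (d X) - nm (d (d X)))]

lemma fa_coercive (c ρ : ℝ) (hc : 0 ≤ c) (hρ : 0 < ρ) : ∃ m : ℝ, 0 < m ∧ ∀ X,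
    ρ * nm X ^ 2 ≤ (fa c X X).re → m * n2 X ^ 2 ≤ (fa c X X).re := by
  refine ⟨ρ / (10 * ρ + 25), by positivity, fun X h => ?_⟩
  have h1 := fa_garding c X
  have h2 := n2_sq_le X
  rw [div_mul_eq_mul_div, div_le_iff₀ (by positivity)]
  have h3 : n2 X ^ 2 ≤ 10 * (fa c X X).re + 25 * nm X ^ 2 := by
    nlinarith [mul_nonneg hc (sq_nonneg (nm X))]
  nlinarith

lemma fa_of_zero (c : ℝ) (X : Sw) (h : d X 0 = 0) : c * nm X ^ 2 ≤ (fa c X X).re := by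
  have h1 := a0_nonneg (d X) h
  have h3 : (fa c X X).re = (a0 (d X) (d X)).re + c * nm X ^ 2 := by
    rw [fa_eq, ip_self, ← Complex.ofReal_mul]; simp [pow_two]
  linarith

/-- the resolvent equation for the antiderivative -/
def Eqn (c : ℝ) (l : ℂ) (W H : Sw) : Prop := l • d W + N c W = d H

lemma energy {c : ℝ} {l : ℂ} {W H : Sw} (h : Eqn c l W H) :
    l.re * (fa c W W).re = (fa c W H).re := by
  have h1 := ip_d_self_re (l • W - H)
  have h2 : d (l • W - H) = - N c W := by
    rw [map_sub, map_smul, ← h]; abel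
  rw [h2, ip_neg_right, Complex.neg_re, neg_eq_zero] at h1
  have h3 : (ip (N c W) (l • W - H)).re = 0 := by
    rw [← ip_symm, Complex.conj_re]; exact h1
  rw [ip_sub_right, ip_smul_right, Complex.sub_re, Complex.mul_re] at h3
  have h4 := fa_self_im c W
  simp only [fa] at h4 ⊢
  rw [h4] at h3
  linarith

/-- real-variable absorption lemma -/
lemma absorb (m C t v h : ℝ) (hm : 0 < m) (hC : 0 ≤ C) (ht : 0 ≤ t) (hv : 0 ≤ v)
    (hh : 0 ≤ h)    (H : m * t ^ 2 + m * v ^ 2 ≤ C * (t + v) * h) : t + v ≤ 2 * C / m * h := by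
  rcases eq_or_lt_of_le (add_nonneg ht hv) with h0 | h0
  · rw [← h0]; positivity
  · rw [div_mul_eq_mul_div, le_div_iff₀ hm]
    by_contra hcon
    push Not at hcon
    nlinarith [sq_nonneg (t - v), mul_lt_mul_of_pos_right hcon h0]

end KP

namespace KP
open Filter Topology Polynomial
open scoped ComplexConjugate

lemma habs {n : ℝ} (h0 : 0 ≤ n) (h1 : n < 1) : |n / 2| < ((1 : ℕ) : ℝ) / 2 := by
  rw [abs_of_nonneg (by linarith)]; push_cast; linarith
lemma habs' {n : ℝ} (h0 : 0 ≤ n) (h1 : n < 1) : |-(n / 2)| < ((1 : ℕ) : ℝ) / 2 := by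
  rw [abs_neg]; exact habs h0 h1

/-- decaying adjoint eigenfunction (growing on the right) -/
noncomputable def Fp (n : ℝ) (h0 : 0 ≤ n) (h1 : n < 1) : Sw := G 1 (n / 2) (habs h0 h1) (C n - X)
/-- its reflection -/
noncomputable def Fm (n : ℝ) (h0 : 0 ≤ n) (h1 : n < 1) : Sw := G 1 (-(n / 2)) (habs' h0 h1) (C n + X)

lemma N_Fp (n : ℝ) (h0 : 0 ≤ n) (h1 : n < 1) :
    N (3 * (1 - n ^ 2) ^ 2 / 16) (Fp n h0 h1) = ((-(n * (1 - n ^ 2) / 2) : ℝ) : ℂ) • d (Fp n h0 h1) := by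
  rw [N_apply, Fp]
  simp only [d_G, q_G, G_smul, G_add, G_sub]
  congr 1
  apply Polynomial.funext
  intro r
  simp [del]
  ring

lemma N_Fm (n : ℝ) (h0 : 0 ≤ n) (h1 : n < 1) :
    N (3 * (1 - n ^ 2) ^ 2 / 16) (Fm n h0 h1) = (((n * (1 - n ^ 2) / 2) : ℝ) : ℂ) • d (Fm n h0 h1) := by
  rw [N_apply, Fm]
  simp only [d_G, q_G, G_smul, G_add, G_sub]
  congr 1
  apply Polynomial.funext
  intro r
  simp [del]
  ring

lemma Fp_zero (n : ℝ) (h0 : 0 ≤ n) (h1 : n < 1) : Fp n h0 h1 0 = n := by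
  simp [Fp, G_apply, gfun]
lemma Fm_zero (n : ℝ) (h0 : 0 ≤ n) (h1 : n < 1) : Fm n h0 h1 0 = n := by
  simp [Fm, G_apply, gfun]
lemma dFp_zero (n : ℝ) (h0 : 0 ≤ n) (h1 : n < 1) : d (Fp n h0 h1) 0 = (((n ^ 2 - 1) / 2 : ℝ) : ℂ) := by
  rw [Fp, d_G, G_apply]
  congr 1
  simp [gfun, del]
  ring
lemma dFm_zero (n : ℝ) (h0 : 0 ≤ n) (h1 : n < 1) : d (Fm n h0 h1) 0 = ((-((n ^ 2 - 1) / 2) : ℝ) : ℂ) := by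
  rw [Fm, d_G, G_apply]
  congr 1
  simp [gfun, del]
  ring

lemma nm_pos (f : Sw) (x : ℝ) (h : f x ≠ 0) : 0 < nm f := by
  rw [lt_iff_le_and_ne]
  refine ⟨nm_nonneg f, fun h0 => h ?_⟩
  have h1 : io f = 0 := norm_eq_zero.mp h0.symm
  have h2 : Function.Injective (io : Sw → _) := SchwartzMap.injective_toLp 2 volume
  have h3 : f = 0 := h2 (by rw [h1, map_zero])
  rw [h3]; rfl

/-- pairing with an eigenfunction of the adjoint problem -/
lemma pairing {c : ℝ} {l : ℂ} {W H F : Sw} (h : Eqn c l W H) {s : ℝ}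
    (hF : N c F = (s : ℂ) • d F) : (l - s) * ip F (d W) = ip F (d H) := by
  have h1 : ip F (N c W) = s * ip (d F) W := by
    rw [← fa_N, fa, hF, ip_smul_left, Complex.conj_ofReal]
  rw [← h, ip_add_right, ip_smul_right, h1, ip_d]
  ring

lemma pairing_fa {c : ℝ} {W F : Sw} {s : ℝ} (hF : N c F = (s : ℂ) • d F) :
    fa c F W = - s * ip F (d W) := by
  rw [fa, hF, ip_smul_left, Complex.conj_ofReal, ip_d]; ring

lemma pairing_le {c : ℝ} {l : ℂ} {W H F : Sw} (h : Eqn c l W H) {s : ℝ}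
    (hF : N c F = (s : ℂ) • d F) (hs : |s| < l.re) :
    ‖fa c F W‖ ≤ |s| * (nm F / (l.re - |s|)) * n2 H := by
  have h1 := congrArg norm (pairing h hF)
  rw [norm_mul] at h1
  have h2 : l.re - |s| ≤ ‖l - s‖ := by
    have := Complex.re_le_norm (l - s)
    simp at this
    linarith [le_abs_self s]
  have h3 := ip_le F (d H)
  have h4 := mul_le_mul_of_nonneg_left (nm_d_le_n2 H) (nm_nonneg F)
  have h5 : ‖ip F (d W)‖ ≤ nm F / (l.re - |s|) * n2 H := by
    rw [div_mul_eq_mul_div, le_div_iff₀ (by linarith)]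
    nlinarith [norm_nonneg (ip F (d W))]
  rw [pairing_fa hF, norm_mul, norm_neg, Complex.norm_real, Real.norm_eq_abs, mul_assoc]
  exact mul_le_mul_of_nonneg_left h5 (abs_nonneg s)

/-- energy bound -/
lemma energy_le {c : ℝ} (hc : 0 ≤ c) {l : ℂ} {W H : Sw} (hl : 0 < l.re) (h : Eqn c l W H) :
    (fa c W W).re ≤ (5 + c) / l.re * (n2 W * n2 H) := by
  have h1 := energy h
  have h2 := fa_le c hc W H
  have h3 := Complex.re_le_norm (fa c W H)
  rw [div_mul_eq_mul_div, le_div_iff₀ hl]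
  linarith

/-- Low-order bound. -/
def Low (c γ M : ℝ) : Prop := ∃ C : ℝ, 0 ≤ C ∧ ∀ τ : ℝ, |τ| ≤ M → ∀ W H : Sw,
  Eqn c ((γ : ℂ) + (τ : ℂ) * Complex.I) W H → nm W ≤ C * n2 H

lemma l_re (γ τ : ℝ) : ((γ : ℂ) + (τ : ℂ) * Complex.I).re = γ := by simp

set_option maxHeartbeats 800000 in
lemma low_case1 (n γ M : ℝ) (h0 : 0 < n) (h1 : n < 1) (hγ : n * (1 - n ^ 2) / 2 < γ) :
    Low (3 * (1 - n ^ 2) ^ 2 / 16) γ M := by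
  set c := 3 * (1 - n ^ 2) ^ 2 / 16 with hc
  set σ := n * (1 - n ^ 2) / 2 with hσ
  have hn2 : 0 < 1 - n ^ 2 := by nlinarith
  have hσ0 : 0 < σ := by positivity
  have hγ0 : 0 < γ := hσ0.trans hγ
  have hc0 : 0 < c := by positivity
  set P := Fp n h0.le h1 with hP
  set R := Fm n h0.le h1 with hR
  have NP : N c P = ((-σ : ℝ) : ℂ) • d P := N_Fp n h0.le h1
  have NR : N c R = ((σ : ℝ) : ℂ) • d R := N_Fm n h0.le h1
  have aP : (fa c P P).re = 0 := by
    rw [pairing_fa NP, ← Complex.ofReal_neg, Complex.re_ofReal_mul, ip_d_self_re, mul_zero]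
  have aR : (fa c R R).re = 0 := by
    rw [pairing_fa NR, ← Complex.ofReal_neg, Complex.re_ofReal_mul, ip_d_self_re, mul_zero]
  have hsym : (fa c R P).re = (fa c P R).re := by rw [← fa_symm, Complex.conj_re]
  have hA : 0 < (fa c P R).re := by
    have e1 := fa_of_zero c (P + R) (by
      rw [map_add, add_apply, hP, hR, dFp_zero, dFm_zero]; push_cast; ring)
    have e2 := nm_pos (P + R) 0 (by
      rw [add_apply, hP, hR, Fp_zero, Fm_zero]
      exact_mod_cast (by linarith : n + n ≠ 0))
    simp only [fa_add_left, fa_add_right, Complex.add_re, aP, aR, hsym] at e1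
    have : 0 < c * nm (P + R) ^ 2 := by positivity
    linarith
  set E := P - R with hE
  have hEE : - (fa c E E).re = 2 * (fa c P R).re := by
    simp only [hE, fa_sub_left, fa_sub_right, Complex.sub_re, aP, aR, hsym]; ring
  set A := 2 * (fa c P R).re with hAdef
  have dE : d E 0 = ((n ^ 2 - 1 : ℝ) : ℂ) := by
    rw [hE, map_sub, sub_apply, hP, hR, dFp_zero, dFm_zero]; push_cast; ring
  have dE0 : d E 0 ≠ 0 := by
    rw [dE]; exact_mod_cast (by linarith : n ^ 2 - 1 ≠ 0)
  obtain ⟨m, hm, hcoer⟩ := fa_coercive c c hc0.le hc0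
  set D := |-σ| * (nm P / (γ - |-σ|)) + |σ| * (nm R / (γ - |σ|)) with hD
  have hD0 : 0 ≤ D := by
    have e1 : 0 < γ - |-σ| := by rw [abs_neg, abs_of_pos hσ0]; linarith
    have e2 : 0 < γ - |σ| := by rw [abs_of_pos hσ0]; linarith
    have := nm_nonneg P; have := nm_nonneg R
    positivity
  set m' := min m A with hm'
  have hm'0 : 0 < m' := lt_min hm (by positivity)
  set B := (5 + c) / γ with hB
  have hB0 : 0 < B := by positivity
  have hnE := n2_nonneg E
  set CC := B * (n2 E + 1) + 2 * D with hCC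
  have hCC0 : 0 ≤ CC := by positivity
  refine ⟨(n2 E + 1) * (2 * CC / m'), by positivity, ?_⟩
  intro τ _ W H hEq
  set l := (γ : ℂ) + (τ : ℂ) * Complex.I with hl
  have hlre : l.re = γ := l_re γ τ
  have k1 := pairing_le hEq NP (by rw [hlre, abs_neg, abs_of_pos hσ0]; exact hγ)
  have k2 := pairing_le hEq NR (by rw [hlre, abs_of_pos hσ0]; exact hγ)
  rw [hlre] at k1 k2
  have hδ : ‖fa c E W‖ ≤ D * n2 H := by
    rw [hE, fa_sub_left]
    refine (norm_sub_le _ _).trans ?_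
    rw [hD, add_mul]; linarith
  set κ := d W 0 / d E 0 with hκ
  set V := W - κ • E with hV
  have dV : d V 0 = 0 := by
    rw [hV, map_sub, map_smul, sub_apply, smul_apply, smul_eq_mul, hκ, div_mul_cancel₀ _ dE0, sub_self]
  have cV := hcoer V (fa_of_zero c V dV)
  have dec := fa_decomp c E W κ
  rw [← hV, hEE] at dec
  have en := energy_le hc0.le (by rw [hlre]; exact hγ0) hEq
  rw [hlre] at en
  have hcr : - (‖κ‖ * (D * n2 H)) ≤ (conj κ * fa c E W).re := by
    have e1 := Complex.abs_re_le_norm (conj κ * fa c E W)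
    rw [norm_mul, RCLike.norm_conj] at e1
    have e2 := mul_le_mul_of_nonneg_left hδ (norm_nonneg κ)
    linarith [neg_abs_le (conj κ * fa c E W).re]
  have hW : n2 W ≤ ‖κ‖ * n2 E + n2 V := by
    have e : W = κ • E + V := by rw [hV]; abel
    calc n2 W = n2 (κ • E + V) := by rw [← e]
      _ ≤ _ := (n2_add _ _).trans (by rw [n2_smul])
  have hκ0 := norm_nonneg κ
  have hv0 := n2_nonneg V
  have hh0 := n2_nonneg H
  have hab : ‖κ‖ + n2 V ≤ 2 * CC / m' * n2 H := by
    refine absorb m' CC _ _ _ hm'0 hCC0 hκ0 hv0 hh0 ?_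
    have f1 := mul_le_mul_of_nonneg_right (min_le_left m A) (sq_nonneg (n2 V))
    have f2 := mul_le_mul_of_nonneg_right (min_le_right m A) (sq_nonneg ‖κ‖)
    have f3 := mul_le_mul_of_nonneg_left (mul_le_mul_of_nonneg_right hW hh0) hB0.le
    have f4 : 0 ≤ B * n2 V * n2 E * n2 H := by positivity
    have f5 : 0 ≤ B * ‖κ‖ * n2 H := by positivity
    have f6 : 0 ≤ D * n2 V * n2 H := by positivity
    rw [hCC]
    linarith
  have := nm_le_n2 W
  have g1 : n2 W ≤ (n2 E + 1) * (‖κ‖ + n2 V) := by nlinarith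
  have g2 := mul_le_mul_of_nonneg_left hab (by positivity : 0 ≤ n2 E + 1)
  linarith

lemma low_case3' (γ M c : ℝ) (hγ : 0 < γ) (hc : 0 ≤ c) (ρ : ℝ) (hρ : 0 < ρ)
    (hco : ∀ X, ρ * nm X ^ 2 ≤ (fa c X X).re) : Low c γ M := by
  obtain ⟨m, hm, hcoer⟩ := fa_coercive c ρ hc hρ
  refine ⟨(5 + c) / γ / m, by positivity, ?_⟩
  intro τ _ W H hEq
  have en := energy_le hc (by rw [l_re]; exact hγ) hEq
  rw [l_re] at en
  have h1 := hcoer W (hco W)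
  refine (nm_le_n2 W).trans ?_
  have h0 := n2_nonneg W
  rcases eq_or_lt_of_le h0 with h | h
  · rw [← h]; have := n2_nonneg H; positivity
  · rw [div_mul_eq_mul_div, le_div_iff₀ hm]
    nlinarith

lemma low_case23 (γ M c : ℝ) (hγ : 0 < γ) (hc : 3 / 16 ≤ c) : Low c γ M := by
  set P := Fp 0 le_rfl one_pos with hP
  have NP : N (3 / 16) P = 0 := by
    have := N_Fp 0 le_rfl one_pos
    simpa using this
  have faP : ∀ X, fa (3 / 16) P X = 0 := by
    intro X
    rw [fa, NP, ← zero_smul ℂ P, ip_smul_left]; simp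
  have dP0 : d P 0 ≠ 0 := by
    rw [hP, dFp_zero]; norm_num
  obtain ⟨m, hm, hcoer⟩ := fa_coercive (3 / 16) (3 / 16) (by norm_num) (by norm_num)
  have key : ∀ W : Sw, (fa (3/16) W W).re = (fa (3/16) (W - (d W 0 / d P 0) • P) (W - (d W 0 / d P 0) • P)).re
      ∧ m * n2 (W - (d W 0 / d P 0) • P) ^ 2 ≤ (fa (3/16) W W).re := by
    intro W
    set κ := d W 0 / d P 0 with hκ
    have dV : d (W - κ • P) 0 = 0 := by
      rw [map_sub, map_smul, sub_apply, smul_apply, smul_eq_mul, hκ, div_mul_cancel₀ _ dP0, sub_self]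
    have dec := fa_decomp (3/16) P W κ
    simp only [faP, mul_zero, Complex.zero_re, neg_zero, zero_mul, zero_add] at dec
    refine ⟨dec, ?_⟩
    rw [dec]
    exact hcoer _ (fa_of_zero _ _ dV)
  rcases eq_or_lt_of_le hc with h | h
  · rw [← h]
    have hφ : 0 < nm (d P) := nm_pos _ 0 dP0
    set φ := d P with hφd
    set B := (5 + 3 / 16) / γ / m with hB
    have hB0 : 0 < B := by positivity
    have z1 := nm_nonneg (d φ)
    have z2 := nm_nonneg (N (3/16) φ)
    have z3 := nm_nonneg P
    set C2 := (|γ| + |M|) * nm (d φ) * B + nm (N (3/16) φ) * B + nm φ with hC2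
    have hC20 : 0 ≤ C2 := by positivity
    refine ⟨C2 / (γ * nm φ ^ 2) * nm P + B, by positivity, ?_⟩
    intro τ hτ W H hEq
    set l := (γ : ℂ) + (τ : ℂ) * Complex.I with hl
    have hlre : l.re = γ := l_re γ τ
    obtain ⟨k1, k2⟩ := key W
    set κ := d W 0 / d P 0 with hκ
    set V := W - κ • P with hV
    have hh0 := n2_nonneg H
    have hv0 := n2_nonneg V
    have e : W = κ • P + V := by rw [hV]; abel
    have NW : N (3/16) W = N (3/16) V := by rw [hV, map_sub, map_smul, NP]; simp
    have hv : n2 V ≤ B * n2 H := by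
      have en := energy hEq
      rw [hlre] at en
      have e2 : fa (3/16) W H = fa (3/16) V H := by rw [fa, NW, fa]
      rw [e2] at en
      have e3 := fa_le (3/16) (by norm_num) V H
      have e4 := Complex.re_le_norm (fa (3/16) V H)
      rcases eq_or_lt_of_le hv0 with h | h
      · rw [← h]; positivity
      · rw [hB, div_mul_eq_mul_div, le_div_iff₀ hm, div_mul_eq_mul_div, le_div_iff₀ hγ]
        have e5 := mul_le_mul_of_nonneg_left k2 hγ.le
        nlinarith
    have hpair : l * κ * ((nm φ ^ 2 : ℝ) : ℂ) = l * ip (d φ) V - ip (N (3/16) φ) V + ip φ (d H) := by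
      rw [← hEq, ip_add_right, ip_smul_right, NW, ← fa_N, fa]
      have e1 : ip φ (d W) = - ip (d φ) W := by linear_combination ip_d φ W
      have e2 : ip (d φ) W = κ * ip (d φ) P + ip (d φ) V := by
        conv_lhs => rw [e]
        rw [ip_add_right, ip_smul_right]
      have e3 : ip (d φ) P = - ip φ φ := by rw [ip_d]
      rw [e1, e2, e3, ip_self]
      ring
    have hln : γ ≤ ‖l‖ := by rw [← hlre]; exact Complex.re_le_norm l
    have hlu : ‖l‖ ≤ |γ| + |M| := by
      refine (norm_add_le _ _).trans ?_
      rw [norm_mul, Complex.norm_I, mul_one, Complex.norm_real, Complex.norm_real, Real.norm_eq_abs, Real.norm_eq_abs]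
      linarith [le_abs_self M]
    have hVn : nm V ≤ B * n2 H := (nm_le_n2 V).trans hv
    have hk : ‖κ‖ ≤ C2 / (γ * nm φ ^ 2) * n2 H := by
      rw [div_mul_eq_mul_div, le_div_iff₀ (by positivity)]
      have p1 := congrArg norm hpair
      rw [norm_mul, norm_mul, Complex.norm_real, Real.norm_eq_abs, abs_of_nonneg (sq_nonneg _)] at p1
      have p2 := norm_add_le (l * ip (d φ) V - ip (N (3/16) φ) V) (ip φ (d H))
      have p3 := norm_sub_le (l * ip (d φ) V) (ip (N (3/16) φ) V)
      rw [norm_mul] at p3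
      have p4 : ‖l‖ * ‖ip (d φ) V‖ ≤ (|γ| + |M|) * (nm (d φ) * (B * n2 H)) := by
        refine mul_le_mul hlu ((ip_le _ _).trans (mul_le_mul_of_nonneg_left hVn z1)) (norm_nonneg _) (by positivity)
      have p5 := (ip_le (N (3/16) φ) V).trans (mul_le_mul_of_nonneg_left hVn z2)
      have p6 := (ip_le φ (d H)).trans (mul_le_mul_of_nonneg_left (nm_d_le_n2 H) hφ.le)
      have p7 : ‖κ‖ * (γ * nm φ ^ 2) ≤ ‖l‖ * ‖κ‖ * nm φ ^ 2 := by
        have := mul_le_mul_of_nonneg_right hln (by positivity : 0 ≤ ‖κ‖ * nm φ ^ 2)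
        linarith
      rw [hC2]
      linarith
    calc nm W = nm (κ • P + V) := by rw [← e]
      _ ≤ ‖κ‖ * nm P + nm V := (nm_add _ _).trans (by rw [nm_smul])
      _ ≤ _ := by
        have := mul_le_mul_of_nonneg_right hk z3
        linarith
  · refine low_case3' γ M c hγ (by linarith) (c - 3 / 16) (by linarith) ?_
    intro X
    have k := (key X).2
    have h3 : fa c X X = fa (3/16) X X + (((c - 3 / 16) * nm X ^ 2 : ℝ) : ℂ) := by
      rw [fa_eq, fa_eq, ip_self]; push_cast; ring
    rw [h3, Complex.add_re, Complex.ofReal_re]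
    have : 0 ≤ m * n2 (X - (d X 0 / d P 0) • P) ^ 2 := by positivity
    linarith

end KP

namespace KP
open Filter Topology Polynomial
open scoped ComplexConjugate

/-- `L₀ = -∂² + 1 - Q` -/
noncomputable def L0 : Sw →L[ℂ] Sw := - d.comp d + ContinuousLinearMap.id ℂ Sw - q

lemma L0_apply (f : Sw) : L0 f = - d (d f) + f - q f := rfl

lemma ip_L0 (f g : Sw) : ip (L0 f) g = a0 f g := by
  rw [L0_apply, ip_sub_left, ip_add_left, ip_neg_left, ip_d (d f), a0]; ring

lemma N_zero_eq (X : Sw) : N 0 X = - d (L0 (d X)) := by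
  rw [N_apply, L0_apply]
  simp only [map_sub, map_add, map_neg]
  simp
  abel

lemma L0_dQs : L0 (d Qs) = 0 := by
  have : d (d (d Qs)) + q (d Qs) - d Qs = 0 := by
    rw [Qs]
    simp only [d_G, q_G, G_add, G_sub]
    ext x
    rw [G_apply, gfun]
    have : (del 2 0 (del 2 0 (del 2 0 (C 3))) + C 3 * (1 - X ^ 2) * del 2 0 (C 3) - del 2 0 (C 3) : ℝ[X]) = 0 := by
      apply Polynomial.funext
      intro r
      simp [del]
      ring
    rw [this]; simp
  rw [L0_apply, ← neg_eq_zero, ← this]; abel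

lemma L0_Qs : L0 Qs = - Qs + d (d Qs) := by
  have : d (d Qs) + d (d Qs) - (Qs + Qs) + q Qs = 0 := by
    rw [Qs]
    simp only [d_G, q_G, G_add, G_sub]
    ext x
    rw [G_apply, gfun]
    have : (del 2 0 (del 2 0 (C 3)) + del 2 0 (del 2 0 (C 3)) - (C 3 + C 3) + C 3 * (1 - X ^ 2) * C 3 : ℝ[X]) = 0 := by
      apply Polynomial.funext
      intro r
      simp [del]
      ring
    rw [this]; simp
  rw [L0_apply, ← sub_eq_zero, ← neg_eq_zero, ← this]; abel

/-- multiplication by `x` -/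
noncomputable def xm : Sw →L[ℂ] Sw := SchwartzMap.smulLeftCLM ℂ (fun x : ℝ => (x : ℂ))

lemma xm_apply (f : Sw) (x : ℝ) : xm f x = x * f x := by
  unfold xm
  rw [SchwartzMap.smulLeftCLM_apply_apply (by fun_prop)]
  rfl

lemma d_xm (f : Sw) : d (xm f) = f + xm (d f) := by
  apply eq_d_of_hasDeriv
  intro x
  have h1 : (⇑(xm f)) = fun x : ℝ => (x : ℂ) * f x := by funext x; exact xm_apply f x
  rw [h1, add_apply, xm_apply]
  have h := ((hasDerivAt_id x).ofReal_comp).mul (hasDeriv f x)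
  refine h.congr_deriv ?_
  simp

lemma q_xm (f : Sw) : q (xm f) = xm (q f) := by
  ext x; simp only [q_apply, xm_apply]; ring

lemma ip_xm (f g : Sw) : ip (xm f) g = ip f (xm g) := by
  rw [ip_eq, ip_eq]
  congr 1; funext x
  simp only [xm_apply, map_mul, Complex.conj_ofReal]; ring

lemma L0_xm (f : Sw) : L0 (xm f) = xm (L0 f) - (2 : ℂ) • d f := by
  simp only [L0_apply, d_xm, q_xm, map_add, map_sub, map_neg, two_smul]
  abel

/-- the scaling direction -/
noncomputable def ee : Sw := Qs + (1 / 2 : ℂ) • xm (d Qs)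

lemma L0_ee : L0 ee = - Qs := by
  rw [ee, map_add, map_smul, L0_xm, L0_dQs, L0_Qs, map_zero, zero_sub, smul_neg, smul_smul]
  norm_num

lemma ee_zero : ee 0 = 3 := by
  rw [ee, add_apply, smul_apply, xm_apply, Qs_apply, Q]
  simp

lemma ip_Qs_ee : (ip Qs ee).re = 3 / 4 * nm Qs ^ 2 := by
  have h1 : ip Qs (xm (d Qs)) = ip (xm Qs) (d Qs) := (ip_xm _ _).symm
  have h2 := ip_d (xm Qs) Qs
  rw [d_xm, ip_add_left, ip_self, ← ip_symm Qs, ← h1] at h2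
  have h3 := congrArg Complex.re h2
  rw [Complex.add_re, Complex.conj_re, Complex.ofReal_re, Complex.neg_re] at h3
  rw [ee, ip_add_right, ip_smul_right, ip_self, Complex.add_re, Complex.ofReal_re]
  have h4 : ((1 / 2 : ℂ) * ip Qs (xm (d Qs))).re = 1 / 2 * (ip Qs (xm (d Qs))).re := by
    rw [show (1 / 2 : ℂ) = ((1 / 2 : ℝ) : ℂ) by norm_num, Complex.re_ofReal_mul]
  rw [h4]; linarith

lemma a0_add_left (X Y Z : Sw) : a0 (X + Y) Z = a0 X Z + a0 Y Z := by
  simp only [← ip_L0, map_add, ip_add_left]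
lemma a0_sub_left (X Y Z : Sw) : a0 (X - Y) Z = a0 X Z - a0 Y Z := by
  simp only [← ip_L0, map_sub, ip_sub_left]
lemma a0_smul_left (k : ℂ) (X Z : Sw) : a0 (k • X) Z = conj k * a0 X Z := by
  simp only [← ip_L0, map_smul, ip_smul_left]
lemma a0_sub_right (X Y Z : Sw) : a0 Z (X - Y) = a0 Z X - a0 Z Y := by
  simp only [← ip_L0, ip_sub_right]
lemma a0_smul_right (k : ℂ) (X Z : Sw) : a0 Z (k • X) = k * a0 Z X := by
  simp only [← ip_L0, ip_smul_right]
lemma a0_self_eq (X : Sw) : a0 X X = ((a0 X X).re : ℂ) :=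
  (Complex.conj_eq_iff_re.mp (a0_symm X X)).symm

lemma a0_decomp (E W : Sw) (k : ℂ) :
    (a0 W W).re = - (a0 E E).re * ‖k‖ ^ 2 + 2 * (conj k * a0 E W).re
      + (a0 (W - k • E) (W - k • E)).re := by
  have h1 : a0 W E = conj (a0 E W) := (a0_symm E W).symm
  have h2 := Complex.normSq_eq_norm_sq k
  simp only [a0_sub_left, a0_sub_right, a0_smul_left, a0_smul_right, h1]
  rw [a0_self_eq E, ← h2]
  simp [Complex.normSq_apply]
  ring

lemma nm_Qs_pos : 0 < nm Qs := nm_pos Qs 0 (by rw [Qs_apply, Q]; simp)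

/-- constant in the conditional positivity -/
noncomputable def Bc : ℝ := 1 / (3 / 4 * nm Qs ^ 2)

lemma Bc_pos : 0 < Bc := by have := nm_Qs_pos; unfold Bc; positivity

lemma a0_cond (f : Sw) : 0 ≤ (a0 f f).re + Bc * ‖ip Qs f‖ ^ 2 := by
  have hQ := nm_Qs_pos
  have he : ee 0 ≠ 0 := by rw [ee_zero]; norm_num
  have dec := a0_decomp ee f (f 0 / ee 0)
  set κ := f 0 / ee 0 with hκ
  have hv := a0_nonneg (f - κ • ee) (by
    rw [sub_apply, smul_apply, smul_eq_mul, hκ, div_mul_cancel₀ _ he, sub_self])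
  have h1 : (a0 ee ee).re = - (3 / 4 * nm Qs ^ 2) := by
    rw [← ip_L0, L0_ee, ip_neg_left, Complex.neg_re, ip_Qs_ee]
  have h2 : a0 ee f = - ip Qs f := by rw [← ip_L0, L0_ee, ip_neg_left]
  rw [h1, h2] at dec
  have h3 := Complex.abs_re_le_norm (conj κ * -ip Qs f)
  rw [norm_mul, norm_neg, RCLike.norm_conj] at h3
  have h4 := neg_abs_le (conj κ * -ip Qs f).re
  have hA : 0 < 3 / 4 * nm Qs ^ 2 := by positivity
  set A := 3 / 4 * nm Qs ^ 2 with hAd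
  have h5 : 0 ≤ A * ‖κ‖ ^ 2 - 2 * (‖κ‖ * ‖ip Qs f‖) + Bc * ‖ip Qs f‖ ^ 2 := by
    have : A * ‖κ‖ ^ 2 - 2 * (‖κ‖ * ‖ip Qs f‖) + Bc * ‖ip Qs f‖ ^ 2
        = (A * ‖κ‖ - ‖ip Qs f‖) ^ 2 / A := by
      rw [Bc, ← hAd]; field_simp; ring
    rw [this]; positivity
  linarith

/-- the corrected, positive form -/
noncomputable def bb (f : Sw) : ℝ := (a0 f f).re + Bc * ‖ip Qs f‖ ^ 2

lemma bb_nonneg (f : Sw) : 0 ≤ bb f := a0_cond f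

lemma bb_cs (f z : Sw) (t : ℝ) (ht : 0 < t) :
    2 * (a0 f z).re ≤ t⁻¹ * bb f + t * bb z - 2 * Bc * (conj (ip Qs f) * ip Qs z).re := by
  have h := bb_nonneg (f - (t : ℂ) • z)
  have h1 : (a0 (f - (t : ℂ) • z) (f - (t : ℂ) • z)).re
      = (a0 f f).re - 2 * t * (a0 f z).re + t ^ 2 * (a0 z z).re := by
    have h1 : a0 z f = conj (a0 f z) := (a0_symm f z).symm
    simp only [a0_sub_left, a0_sub_right, a0_smul_left, a0_smul_right, h1, Complex.conj_ofReal]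
    simp
    ring
  have h2 : ‖ip Qs (f - (t : ℂ) • z)‖ ^ 2
      = ‖ip Qs f‖ ^ 2 - 2 * t * (conj (ip Qs f) * ip Qs z).re + t ^ 2 * ‖ip Qs z‖ ^ 2 := by
    rw [ip_sub_right, ip_smul_right, ← Complex.normSq_eq_norm_sq, ← Complex.normSq_eq_norm_sq, ← Complex.normSq_eq_norm_sq]
    simp [Complex.normSq_apply]
    ring
  rw [bb, h1, h2] at h
  have h3 : t⁻¹ * bb f + t * bb z - 2 * Bc * (conj (ip Qs f) * ip Qs z).re - 2 * (a0 f z).re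
    = t⁻¹ * (((a0 f f).re - 2 * t * (a0 f z).re + t ^ 2 * (a0 z z).re) + Bc *
      (‖ip Qs f‖ ^ 2 - 2 * t * (conj (ip Qs f) * ip Qs z).re + t ^ 2 * ‖ip Qs z‖ ^ 2)) := by
    unfold bb; field_simp; ring
  have : 0 ≤ t⁻¹ := by positivity
  have := mul_nonneg this h
  linarith

lemma bb_le (f : Sw) : bb f ≤ nm (d f) ^ 2 + (4 + Bc * nm Qs ^ 2) * nm f ^ 2 := by
  have h1 := (Complex.re_le_norm _).trans (a0_le f f)
  have h2 := ip_le Qs f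
  have h3 : ‖ip Qs f‖ ^ 2 ≤ (nm Qs * nm f) ^ 2 := pow_le_pow_left₀ (norm_nonneg _) h2 2
  have h4 := mul_le_mul_of_nonneg_left h3 Bc_pos.le
  unfold bb
  nlinarith

lemma low_case4 (γ M : ℝ) (hγ : 0 < γ) : Low 0 γ M := by
  have hQ := nm_Qs_pos
  have hB := Bc_pos
  set k := nm Qs with hk
  set C1 : ℝ := 2 / γ * ((1 / γ * (5 + Bc * k ^ 2)) / 2 + 2 * (Bc * (k / γ) * k)) with hC1
  have hC10 : 0 ≤ C1 := by positivity
  set t : ℝ := γ / (7 + Bc * k ^ 2) with ht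
  have ht0 : 0 < t := by positivity
  set C2 : ℝ := (t⁻¹ * C1 + t * C1) / 2 with hC2
  have hC20 : 0 ≤ C2 := by positivity
  set D : ℝ := Bc * (k / γ) * k + 1 with hD
  have hD0 : 0 ≤ D := by positivity
  set C3 : ℝ := 4 / γ * (C2 + D ^ 2 / γ) with hC3
  have hC30 : 0 ≤ C3 := by positivity
  refine ⟨√C3, by positivity, ?_⟩
  intro τ _ W H hEq
  set l := (γ : ℂ) + (τ : ℂ) * Complex.I with hl
  have hlre : l.re = γ := l_re γ τ
  have hh0 := n2_nonneg H
  set h := n2 H with hh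
  set w := d W with hw
  -- the integrated equation
  have hL : L0 w = l • W - H := by
    have : d (l • W - H - L0 w) = 0 := by
      rw [map_sub, map_sub, map_smul, ← hEq, N_zero_eq]; abel
    have := eq_zero_of_d _ this
    rw [sub_eq_zero] at this; exact this.symm
  have hN0 : N 0 Qs = ((0 : ℝ) : ℂ) • d Qs := by
    rw [N_zero_eq, L0_dQs, map_zero]; simp
  have hln : γ ≤ ‖l‖ := by rw [← hlre]; exact Complex.re_le_norm l
  have hH1 := nm_d_le_n2 H
  have hH0 := nm_le_n2 H
  have hH2 := nm_dd_le_n2 H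
  have hell : ‖ip Qs w‖ ≤ k / γ * h := by
    have p := congrArg norm (pairing hEq hN0)
    rw [Complex.ofReal_zero, sub_zero, norm_mul] at p
    have p2 := (ip_le Qs (d H)).trans (mul_le_mul_of_nonneg_left hH1 hQ.le)
    rw [div_mul_eq_mul_div, le_div_iff₀ hγ]
    nlinarith [norm_nonneg (ip Qs w)]
  -- first energy estimate
  have hb : bb w ≤ C1 * h ^ 2 := by
    have en := energy hEq
    rw [hlre, fa_eq, fa_eq] at en
    simp only [Complex.ofReal_zero, zero_mul, add_zero] at en
    have cs := bb_cs w (d H) γ⁻¹ (by positivity)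
    rw [inv_inv] at cs
    have bH : bb (d H) ≤ (5 + Bc * k ^ 2) * h ^ 2 := by
      refine (bb_le _).trans ?_
      have e1 := pow_le_pow_left₀ (nm_nonneg _) hH1 2
      have e2 := pow_le_pow_left₀ (nm_nonneg _) hH2 2
      have e3 := mul_le_mul_of_nonneg_left e1 (by positivity : 0 ≤ 4 + Bc * k ^ 2)
      linarith
    have c1 : - (k / γ * h * (k * h)) ≤ (conj (ip Qs w) * ip Qs (d H)).re := by
      have e1 := Complex.abs_re_le_norm (conj (ip Qs w) * ip Qs (d H))
      rw [norm_mul, RCLike.norm_conj] at e1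
      have e2 := mul_le_mul hell ((ip_le Qs (d H)).trans (mul_le_mul_of_nonneg_left hH1 hQ.le)) (norm_nonneg _) (by positivity)
      linarith [neg_abs_le (conj (ip Qs w) * ip Qs (d H)).re]
    have c2 : Bc * ‖ip Qs w‖ ^ 2 ≤ Bc * (k / γ * h) ^ 2 :=
      mul_le_mul_of_nonneg_left (pow_le_pow_left₀ (norm_nonneg _) hell 2) hB.le
    have bdef : bb w = (a0 w w).re + Bc * ‖ip Qs w‖ ^ 2 := rfl
    have c3 := mul_le_mul_of_nonneg_left bH (by positivity : 0 ≤ γ⁻¹)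
    have c4 := mul_le_mul_of_nonneg_left c1 hB.le
    have c5 : γ * bb w ≤ γ / 2 * bb w + γ⁻¹ * ((5 + Bc * k ^ 2) * h ^ 2) / 2
        + Bc * (k / γ * h * (k * h)) + γ * (Bc * (k / γ * h) ^ 2) := by
      have := mul_le_mul_of_nonneg_left c2 hγ.le
      rw [bdef] at cs ⊢
      linarith
    have c6 : γ * (Bc * (k / γ * h) ^ 2) = Bc * (k / γ * h * (k * h)) := by field_simp
    have c7 : C1 * h ^ 2 = 2 / γ * (γ⁻¹ * ((5 + Bc * k ^ 2) * h ^ 2) / 2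
        + 2 * (Bc * (k / γ * h * (k * h)))) := by
      rw [hC1]; ring
    rw [c7, div_mul_eq_mul_div, le_div_iff₀ hγ]
    linarith
  -- interpolation
  set x := nm W with hx
  set y := nm w with hy
  set z := nm (d w) with hz
  have hx0 : 0 ≤ x := nm_nonneg W
  have hz0 : 0 ≤ z := nm_nonneg _
  have i1 : y ^ 2 ≤ x * z := nm_d_sq W
  have i2 : z ^ 2 ≤ C1 * h ^ 2 + 2 * y ^ 2 := by
    have e1 := a0_garding w
    have bdef : bb w = (a0 w w).re + Bc * ‖ip Qs w‖ ^ 2 := rfl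
    have : 0 ≤ Bc * ‖ip Qs w‖ ^ 2 := by positivity
    linarith
  have i3 : y ^ 2 ≤ C1 * h ^ 2 + 3 * x ^ 2 := by nlinarith [sq_nonneg (z - 2 * x), sq_nonneg (z - x)]
  have i4 : bb W ≤ C1 * h ^ 2 + (7 + Bc * k ^ 2) * x ^ 2 := by
    have := bb_le W
    linarith
  -- second estimate
  have f1 : γ * x ^ 2 = (a0 w W).re + (ip H W).re := by
    rw [← ip_L0, hL, ip_sub_left, ip_smul_left, ip_self]
    simp [hlre, pow_two, hx]
  have cs := bb_cs w W t ht0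
  have c1 : - (k / γ * h * (k * x)) ≤ (conj (ip Qs w) * ip Qs W).re := by
    have e1 := Complex.abs_re_le_norm (conj (ip Qs w) * ip Qs W)
    rw [norm_mul, RCLike.norm_conj] at e1
    have e2 := mul_le_mul hell (ip_le Qs W) (norm_nonneg _) (by positivity)
    linarith [neg_abs_le (conj (ip Qs w) * ip Qs W).re]
  have c2 := (Complex.re_le_norm _).trans (ip_le H W)
  have c3 : nm H * x ≤ h * x := mul_le_mul_of_nonneg_right hH0 hx0
  have c4 := mul_le_mul_of_nonneg_left c1 hB.le
  have c5 := mul_le_mul_of_nonneg_left hb (by positivity : 0 ≤ t⁻¹)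
  have c6 := mul_le_mul_of_nonneg_left i4 ht0.le
  have c7 : t * ((7 + Bc * k ^ 2) * x ^ 2) = γ * x ^ 2 := by rw [ht]; field_simp
  have c8 : γ / 2 * x ^ 2 ≤ C2 * h ^ 2 + D * h * x := by
    rw [hC2, hD]; linarith
  have c9 : D * h * x ≤ γ / 4 * x ^ 2 + D ^ 2 / γ * h ^ 2 := by
    have : γ / 4 * x ^ 2 + D ^ 2 / γ * h ^ 2 - D * h * x = (γ * x / 2 - D * h) ^ 2 / γ := by
      field_simp; ring
    have h2 : 0 ≤ (γ * x / 2 - D * h) ^ 2 / γ := by positivity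
    linarith
  have c10 : x ^ 2 ≤ C3 * h ^ 2 := by
    rw [hC3, mul_assoc, div_mul_eq_mul_div, le_div_iff₀ hγ]
    linarith
  have : x ^ 2 ≤ (√C3 * h) ^ 2 := by rw [mul_pow, Real.sq_sqrt hC30]; exact c10
  exact abs_le_of_sq_le_sq' this (by positivity) |>.2

end KP

namespace KP
open Filter Topology
open scoped ComplexConjugate

lemma iter_smul (r : ℕ) (k : ℂ) (X : Sw) : d^[r] (k • X) = k • d^[r] X := by
  induction r generalizing X with
  | zero => rfl
  | succ r ih => rw [Function.iterate_succ_apply, map_smul, ih, Function.iterate_succ_apply]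

/-- From the low-order bound to second order. -/
lemma low_n2 {c γ M : ℝ} (hc : 0 ≤ c) (hγ : 0 < γ) (h : Low c γ M) :
    ∃ C : ℝ, 0 ≤ C ∧ ∀ τ : ℝ, |τ| ≤ M → ∀ W H : Sw,
      Eqn c ((γ : ℂ) + (τ : ℂ) * Complex.I) W H → n2 W ≤ C * n2 H := by
  obtain ⟨C, hC, hlow⟩ := h
  set B := (5 + c) / γ with hB
  have hB0 : 0 ≤ B := by positivity
  refine ⟨√(50 * C ^ 2 + 100 * B ^ 2), by positivity, ?_⟩
  intro τ hτ W H hEq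
  have h1 := hlow τ hτ W H hEq
  have en := energy_le hc (by rw [l_re]; exact hγ) hEq
  rw [l_re] at en
  have g := fa_garding c W
  have e := n2_sq_le W
  have hx := nm_nonneg W
  have hx2 : nm W ^ 2 ≤ (C * n2 H) ^ 2 := pow_le_pow_left₀ hx h1 2
  have hcx : 0 ≤ c * nm W ^ 2 := by positivity
  have : n2 W ^ 2 ≤ (√(50 * C ^ 2 + 100 * B ^ 2) * n2 H) ^ 2 := by
    rw [mul_pow, Real.sq_sqrt (by positivity)]
    nlinarith [sq_nonneg (n2 W - 10 * B * n2 H)]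
  exact abs_le_of_sq_le_sq' this (mul_nonneg (by positivity) (n2_nonneg H)) |>.2

/-- sum of `L²` norms of derivatives -/
noncomputable def hs (r : ℕ) (H : Sw) : ℝ := ∑ i ∈ Finset.range (r + 1), nm (d^[i] H)

lemma hs_nonneg (r : ℕ) (H : Sw) : 0 ≤ hs r H := Finset.sum_nonneg fun _ _ => nm_nonneg _

lemma nm_le_hs {r i : ℕ} (h : i ≤ r) (H : Sw) : nm (d^[i] H) ≤ hs r H :=
  Finset.single_le_sum (f := fun i => nm (d^[i] H)) (fun _ _ => nm_nonneg _)
    (Finset.mem_range.mpr (by omega))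

lemma n2_le_hs {r : ℕ} (h : 2 ≤ r) (H : Sw) : n2 H ≤ 3 * hs r H := by
  have h0 := nm_le_hs (show 0 ≤ r by omega) H
  have h1 := nm_le_hs (show 1 ≤ r by omega) H
  have h2 := nm_le_hs (show 2 ≤ r by omega) H
  simp only [Function.iterate_succ_apply, Function.iterate_zero, id] at h0 h1 h2
  unfold n2; linarith

/-- the bootstrapping inequality -/
lemma boot (c Λ : ℝ) (hc : 0 ≤ c) (r : ℕ) : ∃ C : ℝ, 0 ≤ C ∧ ∀ l : ℂ, ‖l‖ ≤ Λ → ∀ W H : Sw,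
    Eqn c l W H → nm (d^[r + 4] W) ≤ nm (d^[r + 1] H) + Λ * nm (d^[r + 1] W) + nm (d^[r + 2] W)
      + C * ∑ i ∈ Finset.range (r + 2), nm (d^[i + 1] W) + c * nm (d^[r] W) := by
  obtain ⟨C, hC, hmu⟩ := mu_bound (r + 1) Qs
  refine ⟨C, hC, ?_⟩
  intro l hl W H hEq
  have e : d (d (d (d W))) = d H - l • d W + d (d W) - d (q (d W)) - (c : ℂ) • W := by
    unfold Eqn at hEq
    rw [← hEq, N_apply]; abel
  have e2 : d^[r + 4] W = d^[r + 1] H - l • d^[r + 1] W + d^[r + 2] W - d^[r + 1] (q (d W)) - (c : ℂ) • d^[r] W := by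
    rw [Function.iterate_add_apply d r 4]
    change d^[r] (d (d (d (d W)))) = _
    rw [e]
    simp only [iterate_map_sub, iterate_map_add, iter_smul]
    rfl
  rw [e2]
  have t1 := nm_sub (d^[r + 1] H - l • d^[r + 1] W + d^[r + 2] W - d^[r + 1] (q (d W))) ((c : ℂ) • d^[r] W)
  have t2 := nm_sub (d^[r + 1] H - l • d^[r + 1] W + d^[r + 2] W) (d^[r + 1] (q (d W)))
  have t3 := nm_add (d^[r + 1] H - l • d^[r + 1] W) (d^[r + 2] W)
  have t4 := nm_sub (d^[r + 1] H) (l • d^[r + 1] W)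
  rw [nm_smul, Complex.norm_real, Real.norm_eq_abs, abs_of_nonneg hc] at t1
  rw [nm_smul] at t4
  have t5 := hmu (d W)
  simp only [← Function.iterate_succ_apply] at t5
  have t6 := mul_le_mul_of_nonneg_right hl (nm_nonneg (d^[r + 1] W))
  change nm (d^[r + 1] (q (d W))) ≤ _ at t5
  have t7 : ∑ i ∈ Finset.range (r + 1 + 1), nm (d^[i.succ] W) = ∑ i ∈ Finset.range (r + 2), nm (d^[i + 1] W) := rfl
  rw [t7] at t5
  linarith

lemma norm_l_le {γ τ M : ℝ} (hτ : |τ| ≤ M) : ‖(γ : ℂ) + (τ : ℂ) * Complex.I‖ ≤ |γ| + |M| := by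
  refine (norm_add_le _ _).trans ?_
  rw [norm_mul, Complex.norm_I, mul_one, Complex.norm_real, Complex.norm_real, Real.norm_eq_abs, Real.norm_eq_abs]
  linarith [le_abs_self M]

/-- uniform bound of the `m`-th derivative -/
def Bd (c γ M : ℝ) (R m : ℕ) : Prop := ∃ C : ℝ, 0 ≤ C ∧ ∀ τ : ℝ, |τ| ≤ M → ∀ W H : Sw,
  Eqn c ((γ : ℂ) + (τ : ℂ) * Complex.I) W H → nm (d^[m] W) ≤ C * hs R H

lemma Bd_step {c γ M : ℝ} (hc : 0 ≤ c) {R r : ℕ} (hr : r + 1 ≤ R) (h : ∀ i, i ≤ r + 2 → Bd c γ M R i) :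
    Bd c γ M R (r + 4) := by
  obtain ⟨C, hC, hb⟩ := boot c (|γ| + |M|) hc r
  have h' : ∀ i, ∃ Ci : ℝ, 0 ≤ Ci ∧ (i ≤ r + 2 → ∀ τ : ℝ, |τ| ≤ M → ∀ W H : Sw,
      Eqn c ((γ : ℂ) + (τ : ℂ) * Complex.I) W H → nm (d^[i] W) ≤ Ci * hs R H) := by
    intro i
    by_cases hi : i ≤ r + 2
    · obtain ⟨a, b, e⟩ := h i hi
      exact ⟨a, b, fun _ => e⟩
    · exact ⟨0, le_rfl, fun h => absurd h hi⟩
  choose D hD0 hD using h'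
  have hS : 0 ≤ ∑ i ∈ Finset.range (r + 2), D (i + 1) := Finset.sum_nonneg fun i _ => hD0 _
  refine ⟨1 + (|γ| + |M|) * D (r + 1) + D (r + 2) + C * ∑ i ∈ Finset.range (r + 2), D (i + 1)
    + c * D r, ?_, ?_⟩
  · have := hD0 (r + 1); have := hD0 (r + 2); have := hD0 r
    positivity
  · intro τ hτ W H hEq
    refine (hb _ (norm_l_le hτ) W H hEq).trans ?_
    have a1 := nm_le_hs hr H
    have a2 := mul_le_mul_of_nonneg_left (hD (r + 1) (by omega) τ hτ W H hEq) (by positivity : 0 ≤ |γ| + |M|)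
    have a3 := hD (r + 2) (by omega) τ hτ W H hEq
    have a4 := mul_le_mul_of_nonneg_left (hD r (by omega) τ hτ W H hEq) hc
    have a5 : ∑ i ∈ Finset.range (r + 2), nm (d^[i + 1] W) ≤ (∑ i ∈ Finset.range (r + 2), D (i + 1)) * hs R H := by
      rw [Finset.sum_mul]
      refine Finset.sum_le_sum fun i hi => hD (i + 1) ?_ τ hτ W H hEq
      have := Finset.mem_range.mp hi; omega
    have a6 := mul_le_mul_of_nonneg_left a5 hC
    linarith

lemma Bd_all {c γ M : ℝ} (hc : 0 ≤ c) (hγ : 0 < γ) (h : Low c γ M) {R : ℕ} (hR : 2 ≤ R) :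
    ∀ m, m ≤ R → Bd c γ M R m := by
  obtain ⟨C, hC, h2⟩ := low_n2 hc hγ h
  have h3 : ∀ τ : ℝ, |τ| ≤ M → ∀ W H : Sw,
      Eqn c ((γ : ℂ) + (τ : ℂ) * Complex.I) W H → n2 W ≤ 3 * C * hs R H := by
    intro τ hτ W H hEq
    have := mul_le_mul_of_nonneg_left (n2_le_hs hR H) hC
    linarith [h2 τ hτ W H hEq]
  have b0 : Bd c γ M R 0 := ⟨3 * C, by positivity, fun τ hτ W H hEq =>
    (nm_le_n2 W).trans (h3 τ hτ W H hEq)⟩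
  have b1 : Bd c γ M R 1 := ⟨3 * C, by positivity, fun τ hτ W H hEq =>
    (nm_d_le_n2 W).trans (h3 τ hτ W H hEq)⟩
  have b2 : Bd c γ M R 2 := ⟨3 * C, by positivity, fun τ hτ W H hEq =>
    (nm_dd_le_n2 W).trans (h3 τ hτ W H hEq)⟩
  have b4 : Bd c γ M R 4 := by
    refine Bd_step hc (r := 0) (by omega) ?_
    intro i hi
    interval_cases i <;> assumption
  have b3 : Bd c γ M R 3 := by
    obtain ⟨C2, hC2, k2⟩ := b2
    obtain ⟨C4, hC4, k4⟩ := b4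
    refine ⟨C2 + C4, by positivity, ?_⟩
    intro τ hτ W H hEq
    have e2 := k2 τ hτ W H hEq
    have e4 := k4 τ hτ W H hEq
    have e3 : nm (d^[3] W) ^ 2 ≤ nm (d^[2] W) * nm (d^[4] W) := nm_d_sq (d (d W))
    have n2' := nm_nonneg (d^[2] W)
    have n3' := nm_nonneg (d^[3] W)
    have n4' := nm_nonneg (d^[4] W)
    have : nm (d^[3] W) ≤ nm (d^[2] W) + nm (d^[4] W) := by
      by_contra hcon
      push Not at hcon
      nlinarith
    linarith
  intro m
  induction m using Nat.strong_induction_on with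
  | _ m ih =>
    intro hm
    match m, ih, hm with
    | 0, _, _ => exact b0
    | 1, _, _ => exact b1
    | 2, _, _ => exact b2
    | 3, _, _ => exact b3
    | r + 4, ih, hm => exact Bd_step hc (by omega) fun i hi => ih i (by omega) (by omega)

lemma iter_eq (m : ℕ) (f : Sw) : iteratedDeriv m (f : ℝ → ℂ) = ⇑(d^[m] f) := by
  induction m with
  | zero => simp
  | succ m ih =>
    rw [iteratedDeriv_succ, ih, Function.iterate_succ_apply']
    rfl

lemma HsSq_eq (s : ℕ) (f : Sw) : HsSq s f = ∑ m ∈ Finset.range (s + 1), nm (d^[m] f) ^ 2 := by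
  unfold HsSq
  refine Finset.sum_congr rfl fun m _ => ?_
  rw [iter_eq, nm_sq]

lemma hs_sq_le (R : ℕ) (H : Sw) : hs R H ^ 2 ≤ (R + 1) * HsSq R H := by
  rw [HsSq_eq, hs]
  have := sq_sum_le_card_mul_sum_sq (s := Finset.range (R + 1)) (f := fun i => nm (d^[i] H))
  simpa using this

lemma eqn_of_resolvent {L γ τ : ℝ} {k : ℤ} {w W H : Sw} (h : ResolventEq L γ τ k w W H) :
    w = d W ∧ Eqn ((k : ℝ) ^ 2 / L ^ 2) ((γ : ℂ) + (τ : ℂ) * Complex.I) W H := by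
  obtain ⟨h1, h2⟩ := h
  have hw : w = d W := by ext x; exact (h1 x).symm
  refine ⟨hw, ?_⟩
  subst hw
  unfold Eqn
  ext x
  have h3 := h2 x
  have h4 : (fun y => (Q y : ℂ) * d W y) = ⇑(q (d W)) := by funext y; rw [q_apply]
  rw [h4, iter_eq] at h3
  rw [N_apply]
  simp only [add_apply, sub_apply, smul_apply, smul_eq_mul]
  have h5 : d^[3] (d W) x = d (d (d (d W))) x := rfl
  rw [h5, ← d_apply, ← d_apply, ← d_apply] at h3
  rw [← h3]; ring

lemma final_k {L γ M : ℝ} {k : ℤ} (hγ : 0 < γ) (h : Low ((k : ℝ) ^ 2 / L ^ 2) γ M) {s : ℕ} (hs1 : 1 ≤ s) :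
    ∃ C : ℝ, 0 ≤ C ∧ ∀ τ : ℝ, |τ| ≤ M → ∀ w W H : Sw, ResolventEq L γ τ k w W H →
      HsSq s w ≤ C * HsSq (s + 1) H := by
  have hB := Bd_all (by positivity) hγ h (R := s + 1) (by omega)
  have hB' : ∀ m, ∃ C : ℝ, 0 ≤ C ∧ (m ≤ s → ∀ τ : ℝ, |τ| ≤ M → ∀ W H : Sw,
      Eqn ((k : ℝ) ^ 2 / L ^ 2) ((γ : ℂ) + (τ : ℂ) * Complex.I) W H → nm (d^[m + 1] W) ≤ C * hs (s + 1) H) := by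
    intro m
    by_cases hm : m ≤ s
    · obtain ⟨C, hC, hh⟩ := hB (m + 1) (by omega)
      exact ⟨C, hC, fun _ => hh⟩
    · exact ⟨0, le_rfl, fun h => absurd h hm⟩
  choose D hD0 hD using hB'
  have hS : 0 ≤ ∑ m ∈ Finset.range (s + 1), D m ^ 2 := Finset.sum_nonneg fun _ _ => sq_nonneg _
  refine ⟨(∑ m ∈ Finset.range (s + 1), D m ^ 2) * (((s + 1 : ℕ) : ℝ) + 1), by positivity, ?_⟩
  intro τ hτ w W H hR
  obtain ⟨hw, hEq⟩ := eqn_of_resolvent hR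
  rw [HsSq_eq s w, mul_assoc]
  refine le_trans ?_ (mul_le_mul_of_nonneg_left (hs_sq_le (s + 1) H) hS)
  rw [Finset.sum_mul]
  refine Finset.sum_le_sum fun m hm => ?_
  have := hD m (by have := Finset.mem_range.mp hm; omega) τ hτ W H hEq
  rw [hw, ← mul_pow]
  exact pow_le_pow_left₀ (nm_nonneg _) this 2

lemma sigma_bdd (L : ℝ) : BddAbove {x : ℝ | ∃ μ : ℝ, 1 < μ ∧ μ < 2 ∧ x = μ * (μ - 1) * (2 - μ) / 2 ∧
    ∃ k : ℤ, (k : ℝ) = √3 * L / 4 * (μ * (2 - μ))} := by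
  refine ⟨2, ?_⟩
  rintro x ⟨μ, h1, h2, rfl, _⟩
  nlinarith [mul_pos (sub_pos.mpr h1) (sub_pos.mpr h2)]

lemma sigma0_nonneg (L : ℝ) : 0 ≤ sigma0 L := by
  unfold sigma0
  apply Real.sSup_nonneg
  rintro x ⟨μ, h1, h2, rfl, _⟩
  have : 0 < μ - 1 := by linarith
  have : 0 < 2 - μ := by linarith
  have : 0 < μ := by linarith
  positivity

lemma low_k {L γ M : ℝ} (hL : 0 < L) (hγ : sigma0 L < γ) (k : ℤ) : Low ((k : ℝ) ^ 2 / L ^ 2) γ M := by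
  have hγ0 : 0 < γ := (sigma0_nonneg L).trans_lt hγ
  by_cases hk : k = 0
  · subst hk
    simpa using low_case4 γ M hγ0
  by_cases hc : 3 / 16 ≤ (k : ℝ) ^ 2 / L ^ 2
  · exact low_case23 γ M _ hγ0 hc
  push Not at hc
  have hs3 : 0 < √3 := by positivity
  have hs32 : √3 ^ 2 = 3 := Real.sq_sqrt (by norm_num)
  set j : ℝ := |(k : ℝ)| / L with hj
  have hj2 : (k : ℝ) ^ 2 / L ^ 2 = j ^ 2 := by rw [hj, div_pow, sq_abs]
  have hkr : (k : ℝ) ≠ 0 := by exact_mod_cast hk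
  have hj0 : 0 < j := by positivity
  rw [hj2] at hc ⊢
  have hjlt : 4 * j / √3 < 1 := by
    rw [div_lt_one hs3]
    by_contra hcon
    push Not at hcon
    nlinarith
  set n := √(1 - 4 * j / √3) with hn
  have hn2 : n ^ 2 = 1 - 4 * j / √3 := Real.sq_sqrt (by linarith)
  have hjp : 0 < 4 * j / √3 := by positivity
  have hn0 : 0 < n := Real.sqrt_pos.mpr (by linarith)
  have hn1 : n < 1 := by nlinarith
  have hcn : j ^ 2 = 3 * (1 - n ^ 2) ^ 2 / 16 := by
    rw [hn2]
    have : (1 - (1 - 4 * j / √3)) ^ 2 = 16 * j ^ 2 / √3 ^ 2 := by ring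
    rw [this, hs32]; ring
  rw [hcn]
  refine low_case1 n γ M hn0 hn1 (lt_of_le_of_lt ?_ hγ)
  unfold sigma0
  refine le_csSup (sigma_bdd L) ⟨1 + n, by linarith, by linarith, by ring, |k|, ?_⟩
  have : (1 + n) * (2 - (1 + n)) = 4 * j / √3 := by nlinarith
  rw [this, hj]
  push_cast
  field_simp

end KP

theorem resolvent_main (L : ℝ) (hL : L > 4 / √3) (s : ℕ) (hs : 1 ≤ s) (K γ₀ M : ℝ)
    (hγ₀ : sigma0 L < γ₀) : ∃ C : ℝ, 0 < C ∧ ∀ τ : ℝ, |τ| ≤ M → ∀ k : ℤ, |(k:ℝ)/L| ≤ K →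
    ∀ w W H : SchwartzMap ℝ ℂ, ResolventEq L γ₀ τ k w W H → HsSq s w ≤ C * HsSq (s+1) H := by
  have hL0 : 0 < L := lt_trans (by positivity) hL
  have hγ0 : 0 < γ₀ := (KP.sigma0_nonneg L).trans_lt hγ₀
  have h := fun k : ℤ => KP.final_k (L := L) (M := M) hγ0 (KP.low_k hL0 hγ₀ k) hs
  choose D hD0 hD using h
  set m : ℤ := ⌈K * L⌉ with hm
  have hS : 0 ≤ ∑ k ∈ Finset.Icc (-m) m, D k := Finset.sum_nonneg fun k _ => hD0 k
  refine ⟨(∑ k ∈ Finset.Icc (-m) m, D k) + 1, by positivity, ?_⟩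
  intro τ hτ k hk w W H hR
  refine (hD k τ hτ w W H hR).trans ?_
  have hHs : 0 ≤ HsSq (s + 1) H := by
    rw [KP.HsSq_eq]; exact Finset.sum_nonneg fun _ _ => sq_nonneg _
  refine mul_le_mul_of_nonneg_right ?_ hHs
  have hmem : k ∈ Finset.Icc (-m) m := by
    rw [abs_div, abs_of_pos hL0, div_le_iff₀ hL0, abs_le] at hk
    have hc := Int.le_ceil (K * L)
    rw [Finset.mem_Icc]
    constructor
    · have : (-(m:ℝ)) ≤ k := by linarith [hk.1]
      exact_mod_cast this
    · have : (k:ℝ) ≤ m := hk.2.trans hc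
      exact_mod_cast this
  have := Finset.single_le_sum (f := D) (fun k _ => hD0 k) hmem
  linarith

/-- Bounded-frequency resolvent estimate: for `L > 4/√3`, `γ₀ > σ₀` and `|τ| ≤ M`,
`‖w‖²_{H^s} ≤ C ‖H‖²_{H^{s+1}}`, uniformly in `|k/L| ≤ K`. -/
theorem resolvent_estimate_bounded_frequency (L : ℝ) (hL : L > 4 / Real.sqrt 3)
    (s : ℕ) (hs : 1 ≤ s) (K γ₀ M : ℝ) (hK : 0 < K) (hγ₀ : sigma0 L < γ₀) (hM : 0 < M) :
    ∃ C : ℝ, 0 < C ∧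
      ∀ τ : ℝ, |τ| ≤ M → ∀ k : ℤ, |(k : ℝ) / L| ≤ K →
        ∀ w W H : SchwartzMap ℝ ℂ, ResolventEq L γ₀ τ k (⇑w) (⇑W) (⇑H) →
          HsSq s (⇑w) ≤ C * HsSq (s + 1) (⇑H) := by
  exact resolvent_main L hL s hs K γ₀ M hγ₀
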